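/- Under the hypotheses of the mixed-radix partition theorem (r_1 | r_2 | ... | r_{s+1}), if there exist positive integers c, d such that p(m_1 n + c) ≡ 0 (mod d) for all n ≥ 0, then P(A; m_1 n + c) ≡ 0 (mod d) for all n ≥ 0 — assuming additionally r_1 = 1 so that the residue classes align. -/

import Mathlib

open scoped Classical

/-- Number of partitions of `n` whose part multiplicities all lie in `A`. -/
noncomputable def partP (A : Set ℕ) (n : ℕ) : ℕ :=
  (Finset.univ.filter (fun p : Nat.Partition n =>
    ∀ i ∈ p.parts, Multiset.count i p.parts ∈ A)).card

/-- Number of partitions of `n` whose parts all lie in `B`. -/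
noncomputable def partQ (B : Set ℕ) (n : ℕ) : ℕ :=
  (Finset.univ.filter (fun p : Nat.Partition n => ∀ i ∈ p.parts, i ∈ B)).card

/-- The coefficient `m₁⋯m_{i-1} rᵢ` in the mixed-radix construction. -/
def mixCoef (s : ℕ) (m : Fin s → ℕ) (r : Fin (s + 1) → ℕ) (i : Fin (s + 1)) : ℕ :=
  (∏ t ∈ Finset.univ.filter (fun t : Fin s => (t : ℕ) < (i : ℕ)), m t) * r i

section Transcendence

theorem pentagonal_rigidity {ℓ : ℕ} (hℓ : ℓ.Prime) {i₀ i I B a D : ℕ} {k k' : ℤ}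
    (hi₀ : i₀ ≤ i) (hi : i ≤ I) (ha : a ≤ B) (hD : D ≤ B) (hk : (ℓ : ℤ) ∣ k)
    (hkB : 24 * (B : ℤ) + ℓ ^ (2 * I) < k)
    (h : a + ℓ ^ (2 * i) * pentagonal k' = D + ℓ ^ (2 * i₀) * pentagonal k) :
    i = i₀ ∧ a = D := by
  have hℓ1 : (1 : ℤ) ≤ ℓ := by exact_mod_cast hℓ.one_le
  have hp := two_mul_natCast_pentagonal k
  have hp' := two_mul_natCast_pentagonal k'
  have hz : (a : ℤ) + ℓ ^ (2 * i) * pentagonal k' = D + ℓ ^ (2 * i₀) * pentagonal k := by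
    exact_mod_cast h
  set x : ℤ := ℓ ^ i₀ * (6 * k - 1) with hx
  set y : ℤ := ℓ ^ i * (6 * k' - 1) with hy
  have hxy : x ^ 2 - y ^ 2 = 24 * ((a : ℤ) - D) + ℓ ^ (2 * i₀) - ℓ ^ (2 * i) := by
    have e1 : x ^ 2 = ℓ ^ (2 * i₀) * (24 * (pentagonal k : ℤ) + 1) := by
      rw [hx, mul_pow, ← pow_mul, mul_comm i₀ 2]
      congr 1
      linarith
    have e2 : y ^ 2 = ℓ ^ (2 * i) * (24 * (pentagonal k' : ℤ) + 1) := by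
      rw [hy, mul_pow, ← pow_mul, mul_comm i 2]
      congr 1
      linarith
    rw [e1, e2]
    linarith
  have hpow1 : (ℓ : ℤ) ^ (2 * i) ≤ ℓ ^ (2 * I) := pow_le_pow_right₀ hℓ1 (by omega)
  have hpow2 : (ℓ : ℤ) ^ (2 * i₀) ≤ ℓ ^ (2 * i) := pow_le_pow_right₀ hℓ1 (by omega)
  have hpow3 : (0 : ℤ) < ℓ ^ (2 * i₀) := by positivity
  have hkpos : 0 < k := by
    have : (0 : ℤ) < ℓ ^ (2 * I) := by positivity
    have : (0 : ℤ) ≤ B := by positivity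
    linarith
  have hxk : k ≤ x := by
    have : (1 : ℤ) ≤ ℓ ^ i₀ := one_le_pow₀ hℓ1
    rw [hx]
    nlinarith
  have hsq : x = |y| := by
    have haB : (a : ℤ) ≤ B := by exact_mod_cast ha
    have hDB : (D : ℤ) ≤ B := by exact_mod_cast hD
    have ha0 : (0 : ℤ) ≤ a := by positivity
    have hD0 : (0 : ℤ) ≤ D := by positivity
    rw [← sq_abs y] at hxy
    have hy0 := abs_nonneg y
    rcases lt_trichotomy x |y| with hlt | heq | hgt
    · nlinarith
    · exact heq
    · nlinarith
  have hii : i = i₀ := by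
    by_contra hne
    have hdvd : (ℓ : ℤ) ∣ 6 * k - 1 := by
      obtain ⟨t, rfl⟩ : ∃ t, i = i₀ + (t + 1) := ⟨i - i₀ - 1, by omega⟩
      have h1 : (ℓ : ℤ) ^ i₀ * (6 * k - 1) = ℓ ^ i₀ * (ℓ * (ℓ ^ t * |6 * k' - 1|)) := by
        rw [← hx, hsq, hy, abs_mul, abs_of_nonneg (by positivity : (0 : ℤ) ≤ ℓ ^ (i₀ + (t + 1)))]
        ring
      have h2 := mul_left_cancel₀ (by positivity) h1
      exact ⟨_, h2⟩
    have h1 : (ℓ : ℤ) ∣ 1 := by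
      have := (hk.mul_left 6).sub hdvd
      simpa using this
    have := Int.le_of_dvd one_pos h1
    have := hℓ.two_le
    omega
  refine ⟨hii, ?_⟩
  subst hii
  rw [hsq, sq_abs] at hxy
  omega

open PowerSeries in
theorem PowerSeries.pow_prime_pow_eq_expand {ℓ : ℕ} [Fact ℓ.Prime] (F : (ZMod ℓ)⟦X⟧) (n : ℕ)
    (h : ℓ ^ n ≠ 0) : F ^ ℓ ^ n = F.expand (ℓ ^ n) h := by
  have := MvPowerSeries.map_iterateFrobenius_expand ℓ (Fact.out : ℓ.Prime).ne_zero F n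
  rw [← this]
  have h2 : iterateFrobenius (ZMod ℓ) ℓ n = RingHom.id _ := by
    ext x
    simp [iterateFrobenius_def, ZMod.pow_card_pow]
  rw [h2, MvPowerSeries.map_id]
  rfl

open PowerSeries in
theorem linearIndependent_pentagonalSeries_pow {ℓ : ℕ} [Fact ℓ.Prime] :
    LinearIndependent (Polynomial (ZMod ℓ))
      (fun i : ℕ ↦ pentagonalSeries (ZMod ℓ) ^ ℓ ^ (2 * i)) := by
  have hℓ : ℓ.Prime := Fact.out
  rw [linearIndependent_iff']
  intro s g hg
  by_contra! hcon
  obtain ⟨j, hjs, hj⟩ := hcon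
  have hne : (s.filter (fun i ↦ g i ≠ 0)).Nonempty := ⟨j, by simp [hjs, hj]⟩
  set i₀ := (s.filter (fun i ↦ g i ≠ 0)).min' hne with hi₀
  have hi₀mem := Finset.min'_mem _ hne
  rw [← hi₀, Finset.mem_filter] at hi₀mem
  set D := (g i₀).natDegree
  set I := s.sup id
  set B := s.sup (fun i ↦ (g i).natDegree)
  set t : ℕ := 24 * B + ℓ ^ (2 * I) + 1 with ht
  set k : ℤ := ℓ * t with hk
  have hkB : 24 * (B : ℤ) + ℓ ^ (2 * I) < k := by
    have h1 : (1 : ℤ) ≤ ℓ := by exact_mod_cast hℓ.one_le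
    have h2 : (t : ℤ) = 24 * (B : ℤ) + ℓ ^ (2 * I) + 1 := by rw [ht]; push_cast; ring
    have h3 : (0 : ℤ) ≤ t := by positivity
    nlinarith
  have hcoeff := congrArg (coeff (D + ℓ ^ (2 * i₀) * pentagonal k)) hg
  rw [map_sum, Finset.sum_eq_single_of_mem i₀ hi₀mem.1, Algebra.smul_def, coeff_mul,
    Finset.sum_eq_single_of_mem (D, ℓ ^ (2 * i₀) * pentagonal k) (by simp)] at hcoeff
  · rw [PowerSeries.pow_prime_pow_eq_expand _ _ (pow_ne_zero _ hℓ.ne_zero), coeff_expand_mul,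
      coeff_pentagonalSeries_pentagonal, PowerSeries.algebraMap_apply'] at hcoeff
    have h1 : (g i₀).coeff D ≠ 0 := by simpa [D] using hi₀mem.2
    simp only [Algebra.algebraMap_self, map_id, id_eq, Polynomial.coeff_coe, map_zero] at hcoeff
    rcases mul_eq_zero.mp hcoeff with h | h
    · exact h1 (by simpa using h)
    · rcases Int.even_or_odd k with hk' | hk'
      · simp [Int.negOnePow_even _ hk'] at h
      · simp [Int.negOnePow_odd _ hk'] at h
  · rintro ⟨a, b⟩ hab hne'
    rw [Finset.HasAntidiagonal.mem_antidiagonal] at hab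
    by_contra hcon
    obtain ⟨h1, h2⟩ := mul_ne_zero_iff.mp hcon
    rw [PowerSeries.algebraMap_apply'] at h1
    simp only [Algebra.algebraMap_self, map_id, id_eq, Polynomial.coeff_coe] at h1
    rw [PowerSeries.pow_prime_pow_eq_expand _ _ (pow_ne_zero _ hℓ.ne_zero), coeff_expand] at h2
    split_ifs at h2 with hdvd
    · rw [Ne, coeff_pentagonalSeries_eq_zero_iff, not_not] at h2
      obtain ⟨k', hk'⟩ := h2
      have hb : b = ℓ ^ (2 * i₀) * pentagonal k' := by rw [hk', Nat.mul_div_cancel' hdvd]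
      have ha : a ≤ D := Polynomial.le_natDegree_of_ne_zero (by simpa using h1)
      have hDB : D ≤ B := Finset.le_sup (f := fun i ↦ (g i).natDegree) hi₀mem.1
      have := pentagonal_rigidity hℓ le_rfl (Finset.le_sup (f := id) hi₀mem.1)
        (ha.trans hDB) hDB (Dvd.intro _ rfl) hkB (hb ▸ hab)
      apply hne'
      ext
      · exact this.2
      · have := this.2
        simp only at *
        omega
    · exact h2 rfl
  · intro i his hi
    by_cases hgi : g i = 0
    · simp [hgi]
    have hle : i₀ ≤ i := Finset.min'_le _ _ (by simp [his, hgi])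
    rw [Algebra.smul_def, coeff_mul]
    apply Finset.sum_eq_zero
    rintro ⟨a, b⟩ hab
    rw [Finset.HasAntidiagonal.mem_antidiagonal] at hab
    by_contra hcon
    obtain ⟨h1, h2⟩ := mul_ne_zero_iff.mp hcon
    rw [PowerSeries.algebraMap_apply'] at h1
    simp only [Algebra.algebraMap_self, map_id, id_eq, Polynomial.coeff_coe] at h1
    rw [PowerSeries.pow_prime_pow_eq_expand _ _ (pow_ne_zero _ hℓ.ne_zero), coeff_expand] at h2
    split_ifs at h2 with hdvd
    · rw [Ne, coeff_pentagonalSeries_eq_zero_iff, not_not] at h2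
      obtain ⟨k', hk'⟩ := h2
      have hb : b = ℓ ^ (2 * i) * pentagonal k' := by rw [hk', Nat.mul_div_cancel' hdvd]
      have ha : a ≤ B := (Polynomial.le_natDegree_of_ne_zero (by simpa using h1)).trans
        (Finset.le_sup (f := fun i ↦ (g i).natDegree) his)
      have hDB : D ≤ B := Finset.le_sup (f := fun i ↦ (g i).natDegree) hi₀mem.1
      exact hi (pentagonal_rigidity hℓ hle (Finset.le_sup (f := id) his)
        ha hDB (Dvd.intro _ rfl) hkB (hb ▸ hab)).1
    · exact h2 rfl

open PowerSeries in
/-- Euler's function modulo a prime is transcendental over the polynomials. -/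
theorem transcendental_pentagonalSeries (ℓ : ℕ) [Fact ℓ.Prime] :
    Transcendental (Polynomial (ZMod ℓ)) (pentagonalSeries (ZMod ℓ)) := by
  intro halg
  obtain ⟨y, hy, hy_int⟩ := halg.exists_integral_multiple
  set z := y • pentagonalSeries (ZMod ℓ) with hz
  have hfg := hy_int.fg_adjoin_singleton
  have : Module.Finite (Polynomial (ZMod ℓ))
      (Subalgebra.toSubmodule (Algebra.adjoin (Polynomial (ZMod ℓ)) {z})) :=
    Module.Finite.iff_fg.mpr hfg
  let v : ℕ → Subalgebra.toSubmodule (Algebra.adjoin (Polynomial (ZMod ℓ)) {z}) := fun i ↦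
    ⟨z ^ ℓ ^ (2 * i), pow_mem (Algebra.self_mem_adjoin_singleton _ z) _⟩
  have hv : LinearIndependent (Polynomial (ZMod ℓ)) v := by
    apply LinearIndependent.of_comp (Submodule.subtype _)
    have hli := linearIndependent_pentagonalSeries_pow (ℓ := ℓ)
    rw [linearIndependent_iff'] at hli ⊢
    intro s g hg i hi
    have := hli s (fun i ↦ g i * y ^ ℓ ^ (2 * i)) (by
      rw [← hg]
      refine Finset.sum_congr rfl fun i _ ↦ ?_
      simp [v, hz, smul_pow, mul_smul]) i hi
    exact (mul_eq_zero.mp this).resolve_right (pow_ne_zero _ hy)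
  exact not_finite_iff_infinite.mpr inferInstance hv.finite_of_isNoetherian

end Transcendence

section PentagonalDependency

open PowerSeries in
theorem eq_zero_of_pentagonalSeries_dependency {ℓ : ℕ} [Fact ℓ.Prime]
    {P : Polynomial (ZMod ℓ)} (hP : P ≠ 0) (s : Finset (ℕ × ℕ)) (c : ℕ × ℕ → ZMod ℓ)
    (h : ∑ i ∈ s, C (c i) * ((P : (ZMod ℓ)⟦X⟧) * pentagonalSeries (ZMod ℓ)) ^ i.1 *
      (X ^ (ℓ - 1) * pentagonalSeries (ZMod ℓ) ^ (24 * (ℓ - 1))) ^ i.2 = 0) :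
    ∀ i ∈ s, c i = 0 := by
  have hℓ : 2 ≤ ℓ := (Fact.out : ℓ.Prime).two_le
  let f : ℕ × ℕ → Polynomial (ZMod ℓ) := fun i ↦
    Polynomial.C (c i) * P ^ i.1 * Polynomial.X ^ ((ℓ - 1) * i.2)
  let e : ℕ × ℕ → ℕ := fun i ↦ i.1 + 24 * (ℓ - 1) * i.2
  let T : Polynomial (Polynomial (ZMod ℓ)) :=
    ∑ i ∈ s, Polynomial.C (f i) * Polynomial.X ^ e i
  have hT : T = 0 := by
    apply transcendental_iff.mp (transcendental_pentagonalSeries ℓ)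
    rw [← h, map_sum]
    refine Finset.sum_congr rfl fun i _ ↦ ?_
    simp only [map_mul, map_pow, Polynomial.aeval_C, Polynomial.aeval_X, f, e,
      PowerSeries.algebraMap_apply', Algebra.algebraMap_self, PowerSeries.map_id, id_eq,
      Polynomial.coe_C, Polynomial.coe_X]
    ring
  have hf0 : ∀ i, f i = 0 → c i = 0 := by
    intro i hi
    simpa [f, hP] using hi
  have hfdeg : ∀ i, f i ≠ 0 → (f i).natDegree = i.1 * P.natDegree + (ℓ - 1) * i.2 := by
    intro i hi
    have hc : c i ≠ 0 := by
      intro h0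
      exact hi (by simp [f, h0])
    rw [Polynomial.natDegree_mul_X_pow _ (by simpa [hP] using hc),
      Polynomial.natDegree_C_mul hc, Polynomial.natDegree_pow]
  intro i₀ hi₀
  apply hf0
  have hcoeff := congrArg (Polynomial.coeff · (e i₀)) hT
  simp only [T, Polynomial.finsetSum_coeff, Polynomial.coeff_C_mul_X_pow,
    Polynomial.coeff_zero] at hcoeff
  rw [← Finset.sum_filter] at hcoeff
  have hdeg := Polynomial.degree_sum_eq_of_disjoint f (s.filter fun i ↦ e i₀ = e i) (by
    rintro i ⟨hi, hfi⟩ j ⟨hj, hfj⟩ hij hd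
    apply hij
    rw [Finset.mem_filter] at hi hj
    have hd' : (f i).natDegree = (f j).natDegree := Polynomial.natDegree_eq_of_degree_eq hd
    rw [hfdeg i hfi, hfdeg j hfj] at hd'
    have he : i.1 + 24 * (ℓ - 1) * i.2 = j.1 + 24 * (ℓ - 1) * j.2 := hi.2.symm.trans hj.2
    obtain ⟨q, hq⟩ : ∃ q, q = ℓ - 1 := ⟨_, rfl⟩
    have hq1 : 1 ≤ q := by omega
    rw [← hq] at hd' he
    have key : (i.1 : ℤ) * (24 * P.natDegree - 1) = j.1 * (24 * P.natDegree - 1) := by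
      zify at hd' he
      linarith
    have hne : (24 * (P.natDegree : ℤ) - 1) ≠ 0 := by omega
    have h1 : i.1 = j.1 := by exact_mod_cast mul_right_cancel₀ hne key
    have h2 : 24 * q * i.2 = 24 * q * j.2 := by omega
    exact Prod.ext h1 (Nat.eq_of_mul_eq_mul_left (by positivity) h2))
  rw [hcoeff, Polynomial.degree_zero] at hdeg
  have := Finset.le_sup (f := fun i ↦ (f i).degree)
    (Finset.mem_filter.mpr ⟨hi₀, rfl⟩ : i₀ ∈ s.filter fun i ↦ e i₀ = e i)
  rw [← hdeg] at this
  exact Polynomial.degree_eq_bot.mp (le_bot_iff.mp this)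

end PentagonalDependency

section Factorization

open PowerSeries
open scoped PowerSeries.WithPiTopology

/-- The generating function of the number of partitions with multiplicities in `A`. -/
noncomputable def partPSeries (A : Set ℕ) : ℤ⟦X⟧ := PowerSeries.mk fun n ↦ (partP A n : ℤ)

/-- The generating function of the partition numbers. -/
noncomputable def partitionSeries : ℤ⟦X⟧ :=
  PowerSeries.mk fun n ↦ (Fintype.card (Nat.Partition n) : ℤ)

theorem partPSeries_eq_genFun (A : Set ℕ) :
    partPSeries A = Nat.Partition.genFun fun _ c ↦ if c ∈ A then (1 : ℤ) else 0 := by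
  ext n
  simp only [partPSeries, coeff_mk, Nat.Partition.coeff_genFun, partP, Finset.card_filter,
    Finsupp.prod, Multiset.toFinsupp_support, Multiset.toFinsupp_apply, Nat.cast_sum]
  refine Finset.sum_congr rfl fun p _ ↦ ?_
  split_ifs with h
  · exact Nat.cast_one.trans
      (Finset.prod_eq_one fun i hi ↦ if_pos (h i (Multiset.mem_toFinset.mp hi))).symm
  · push Not at h
    obtain ⟨i, hi, hiA⟩ := h
    exact Nat.cast_zero.trans
      (Finset.prod_eq_zero (Multiset.mem_toFinset.mpr hi) (if_neg hiA)).symm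

theorem partPSeries_univ : partPSeries Set.univ = partitionSeries := by
  ext n
  simp [partPSeries, partitionSeries, partP]

theorem one_add_tsum_eq_expand {R : Type*} [CommRing R] [TopologicalSpace R] [T2Space R]
    (f : ℕ → R) (hf : f 0 = 1) (i : ℕ) :
    1 + ∑' j, f (j + 1) • (X : R⟦X⟧) ^ ((i + 1) * (j + 1)) =
      (PowerSeries.mk f).expand (i + 1) i.succ_ne_zero := by
  have hs : Summable fun j ↦ f (j + 1) • (X : R⟦X⟧) ^ ((i + 1) * (j + 1)) :=
    Nat.Partition.summable_genFun_term (fun _ c ↦ f c) i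
  ext n
  rw [map_add, hs.map_tsum (coeff n) (WithPiTopology.continuous_coeff _ _), coeff_expand]
  simp only [map_smul, coeff_X_pow, coeff_one, smul_eq_mul, mul_ite, mul_one, mul_zero, coeff_mk]
  rcases Nat.eq_zero_or_pos n with rfl | hn
  · simp [hf]
  rw [if_neg hn.ne', zero_add]
  split_ifs with hdvd
  · obtain ⟨q, rfl⟩ := hdvd
    have hq : q ≠ 0 := by
      rintro rfl
      simp at hn
    rw [tsum_eq_single (q - 1), if_pos, Nat.mul_div_cancel_left _ i.succ_pos]
    · congr 1
      omega
    · congr 1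
      omega
    · intro b hb
      rw [if_neg]
      intro h
      have := Nat.eq_of_mul_eq_mul_left i.succ_pos h
      omega
  · refine (tsum_congr fun j ↦ if_neg ?_).trans tsum_zero
    rintro rfl
    exact hdvd (Dvd.intro _ rfl)

/-- The power series of the indicator function of `A`. -/
noncomputable def indicatorSeries (A : Set ℕ) : ℤ⟦X⟧ :=
  PowerSeries.mk fun n ↦ if n ∈ A then 1 else 0

theorem hasProd_partPSeries_mul_pentagonalSeries {A : Set ℕ} (h0 : 0 ∈ A) :
    HasProd (fun i : ℕ ↦ (indicatorSeries A * (1 - X)).expand (i + 1) i.succ_ne_zero)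
      (partPSeries A * pentagonalSeries ℤ) := by
  have h := Nat.Partition.hasProd_genFun fun _ c ↦ if c ∈ A then (1 : ℤ) else 0
  rw [← partPSeries_eq_genFun] at h
  convert! HasProd.mul h (WithPiTopology.hasProd_one_sub_X_pow ℤ) using 2 with i
  rw [one_add_tsum_eq_expand (fun c ↦ if c ∈ A then (1 : ℤ) else 0) (by simp [h0])]
  simp [indicatorSeries]

theorem partitionSeries_mul_pentagonalSeries : partitionSeries * pentagonalSeries ℤ = 1 := by
  have h := hasProd_partPSeries_mul_pentagonalSeries (Set.mem_univ 0)
  have h1 : indicatorSeries Set.univ * (1 - X) = 1 := by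
    have : indicatorSeries Set.univ = PowerSeries.mk 1 := by
      ext
      simp [indicatorSeries]
    rw [this, mk_one_mul_one_sub_eq_one]
  simp only [h1, map_one] at h
  rw [← partPSeries_univ]
  exact h.unique hasProd_one

theorem coeff_indicatorSeries_mul_one_sub_X {A : Set ℕ} {m : ℕ}
    (hA : ∀ x, x ∈ A ↔ m * (x / m) ∈ A) {n : ℕ} (hn : ¬ m ∣ n) :
    (indicatorSeries A * (1 - X)).coeff n = 0 := by
  obtain ⟨k, rfl⟩ : ∃ k, n = k + 1 := Nat.exists_eq_succ_of_ne_zero (by rintro rfl; simp at hn)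
  rw [mul_sub, mul_one, map_sub, coeff_succ_mul_X]
  simp only [indicatorSeries, coeff_mk]
  rw [sub_eq_zero]
  congr 1
  rw [hA (k + 1), hA k, Nat.succ_div_of_not_dvd hn]

theorem coeff_partPSeries_mul_pentagonalSeries {A : Set ℕ} {m : ℕ} (h0 : 0 ∈ A)
    (hA : ∀ x, x ∈ A ↔ m * (x / m) ∈ A) {n : ℕ} (hn : ¬ m ∣ n) :
    (partPSeries A * pentagonalSeries ℤ).coeff n = 0 := by
  have h := hasProd_partPSeries_mul_pentagonalSeries h0
  rw [HasProd, WithPiTopology.tendsto_iff_coeff_tendsto] at h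
  refine tendsto_nhds_unique (h n) (tendsto_const_nhds.congr fun s ↦ ?_)
  induction s using Finset.induction_on generalizing n with
  | empty => 
    rw [Finset.prod_empty, coeff_one, if_neg]
    rintro rfl
    simp at hn
  | insert i s his ih =>
    rw [Finset.prod_insert his, coeff_mul]
    symm
    refine Finset.sum_eq_zero fun p hp ↦ ?_
    rw [Finset.HasAntidiagonal.mem_antidiagonal] at hp
    by_cases h2 : m ∣ p.2
    · have h1 : ¬ m ∣ p.1 := fun h1 ↦ hn (hp ▸ h1.add h2)
      rw [coeff_expand]
      split_ifs with hdvd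
      · obtain ⟨q, hq⟩ := hdvd
        rw [hq, Nat.mul_div_cancel_left _ i.succ_pos, coeff_indicatorSeries_mul_one_sub_X hA,
          zero_mul]
        rintro h
        exact h1 (hq ▸ h.mul_left _)
      · rw [zero_mul]
    · rw [← ih h2, mul_zero]

theorem dvd_partP_of_dvd_partition {A : Set ℕ} {m : ℕ} (h0 : 0 ∈ A)
    (hA : ∀ x, x ∈ A ↔ m * (x / m) ∈ A) {d c : ℕ}
    (h : ∀ N, N ≡ c [MOD m] → d ∣ Fintype.card (Nat.Partition N)) {N : ℕ} (hN : N ≡ c [MOD m]) :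
    d ∣ partP A N := by
  have key : partPSeries A = partPSeries A * pentagonalSeries ℤ * partitionSeries := by
    rw [mul_assoc, mul_comm (pentagonalSeries ℤ), partitionSeries_mul_pentagonalSeries, mul_one]
  have hcoeff := congrArg (coeff N) key
  rw [coeff_mul] at hcoeff
  simp only [partPSeries, partitionSeries, coeff_mk] at hcoeff
  rw [← Int.natCast_dvd_natCast, hcoeff]
  refine Finset.dvd_sum fun p hp ↦ ?_
  rw [Finset.HasAntidiagonal.mem_antidiagonal] at hp
  by_cases h1 : m ∣ p.1
  · refine Dvd.dvd.mul_left (Int.natCast_dvd_natCast.mpr (h _ ?_)) _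
    refine Nat.ModEq.trans ?_ hN
    rw [← hp]
    exact (Nat.modEq_iff_dvd' (Nat.le_add_left _ _)).mpr (by simpa using h1)
  · have := coeff_partPSeries_mul_pentagonalSeries h0 hA h1
    rw [partPSeries] at this
    rw [this, zero_mul]
    exact dvd_zero _

end Factorization

section EulerFunction

open PowerSeries Filter Topology

/-- Euler's function `∏ (1 - q ^ (n + 1))` on the open unit disc. -/
noncomputable def eulerPhi (q : ℂ) : ℂ := ∏' n : ℕ, (1 - q ^ (n + 1))

theorem norm_prod_one_sub_pow_le {q : ℂ} (hq : ‖q‖ < 1) (k n : ℕ) :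
    ‖∏ i ∈ Finset.range n, (1 - q ^ (k + i + 1))‖ ≤ Real.exp (1 - ‖q‖)⁻¹ := by
  have h0 := norm_nonneg q
  calc ‖∏ i ∈ Finset.range n, (1 - q ^ (k + i + 1))‖
      ≤ ∏ i ∈ Finset.range n, Real.exp (‖q‖ ^ i) := by
        rw [norm_prod]
        refine Finset.prod_le_prod (fun _ _ ↦ norm_nonneg _) fun i _ ↦ ?_
        calc ‖1 - q ^ (k + i + 1)‖ ≤ ‖(1 : ℂ)‖ + ‖q ^ (k + i + 1)‖ := norm_sub_le _ _
          _ ≤ ‖q‖ ^ i + 1 := by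
            rw [norm_one, norm_pow]
            have := pow_le_pow_of_le_one h0 hq.le (show i ≤ k + i + 1 by omega)
            linarith
          _ ≤ _ := Real.add_one_le_exp _
    _ = Real.exp (∑ i ∈ Finset.range n, ‖q‖ ^ i) := (Real.exp_sum _ _).symm
    _ ≤ _ := by
      rw [Real.exp_le_exp, ← tsum_geometric_of_lt_one h0 hq]
      exact (summable_geometric_of_lt_one h0 hq).sum_le_tsum _ fun _ _ ↦ by positivity

theorem norm_coeff_pentagonalSeries_le (n : ℕ) : ‖(pentagonalSeries ℂ).coeff n‖ ≤ 1 := by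
  by_cases h : ∃ k, pentagonal k = n
  · obtain ⟨k, rfl⟩ := h
    rw [coeff_pentagonalSeries_pentagonal]
    rcases Int.even_or_odd k with hk | hk
    · simp [Int.negOnePow_even _ hk]
    · simp [Int.negOnePow_odd _ hk]
  · rw [coeff_pentagonalSeries_eq_zero ℂ (by simpa using h)]
    simp

theorem summable_norm_pentagonalSeries {q : ℂ} (hq : ‖q‖ < 1) :
    Summable fun n ↦ ‖(pentagonalSeries ℂ).coeff n * q ^ n‖ := by
  refine (summable_geometric_of_lt_one (norm_nonneg q) hq).of_nonneg_of_le
    (fun _ ↦ norm_nonneg _) fun n ↦ ?_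
  rw [norm_mul, norm_pow]
  exact mul_le_of_le_one_left (by positivity) (norm_coeff_pentagonalSeries_le n)

/-- The pentagonal number theorem for complex numbers in the unit disc. -/
theorem hasSum_pentagonalSeries_eulerPhi {q : ℂ} (hq : ‖q‖ < 1) :
    HasSum (fun n ↦ (pentagonalSeries ℂ).coeff n * q ^ n) (eulerPhi q) := by
  have h0 := norm_nonneg q
  have hs := (summable_norm_pentagonalSeries hq).of_norm
  obtain ⟨S, hS⟩ := hs
  have hS' := hS
  rw [← pentagonal_injective.hasSum_iff fun n hn ↦ by simp [coeff_pentagonalSeries_eq_zero ℂ hn],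
    ← neg_injective.hasSum_iff (fun x hx ↦ by absurd hx; use -x; simp)] at hS
  have hrhs : HasSum (fun k : ℕ ↦ (-1) ^ k * (q ^ pentagonal (-k) - q ^ pentagonal (k + 1))) S := by
    convert! hS.nat_add_neg_add_one using 2 with k
    simp_rw [Function.comp_apply, neg_neg, coeff_pentagonalSeries_pentagonal, Int.negOnePow_add]
    simp
    ring
  have hbound : ∀ k n, ‖q ^ ((k + 1) * n) * ∏ i ∈ Finset.range (n + 1), (1 - q ^ (k + i + 1))‖ ≤
      ‖q‖ ^ n * Real.exp (1 - ‖q‖)⁻¹ := by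
    intro k n
    rw [norm_mul, norm_pow]
    gcongr ?_ * ?_
    · exact pow_le_pow_of_le_one h0 hq.le (by nlinarith)
    · exact norm_prod_one_sub_pow_le hq k (n + 1)
  have hbs : Summable fun n ↦ ‖q‖ ^ n * Real.exp (1 - ‖q‖)⁻¹ :=
    (summable_geometric_of_lt_one h0 hq).mul_right _
  rw [eulerPhi, Pentagonal.tprod_one_sub_pow, hrhs.tsum_eq]
  · exact hS'
  · exact tendsto_pow_atTop_nhds_zero_of_norm_lt_one hq
  · exact fun k ↦ hbs.of_norm_bounded (hbound k)
  · intro k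
    simp_rw [sub_eq_add_neg]
    apply multipliable_one_add_of_summable
    simpa [add_assoc] using
      (summable_nat_add_iff (k + 1)).mpr (summable_geometric_of_lt_one h0 hq)
  · exact hrhs.summable
  · refine squeeze_zero_norm (a := fun k ↦ ‖q‖ ^ k * ∑' n, ‖q‖ ^ n * Real.exp (1 - ‖q‖)⁻¹)
      (fun k ↦ ?_) ?_
    · rw [norm_mul, norm_mul, norm_pow, norm_pow, norm_neg, norm_one, one_pow, one_mul]
      gcongr ?_ * ?_
      · refine pow_le_pow_of_le_one h0 hq.le ?_
        rw [Nat.le_div_iff_mul_le two_pos]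
        nlinarith
      · exact tsum_of_norm_bounded hbs.hasSum (hbound k)
    · simpa using (tendsto_pow_atTop_nhds_zero_of_lt_one h0 hq).mul_const
        (∑' n, ‖q‖ ^ n * Real.exp (1 - ‖q‖)⁻¹)

end EulerFunction

section Representation

open PowerSeries Filter Topology

/-- The power series `F` converges to `f` on the open unit disc. -/
def ConvergesTo (F : ℂ⟦X⟧) (f : ℂ → ℂ) : Prop :=
  ∀ q : ℂ, ‖q‖ < 1 → HasSum (fun n ↦ F.coeff n * q ^ n) (f q)

namespace ConvergesTo

variable {F G : ℂ⟦X⟧} {f g : ℂ → ℂ}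

theorem congr (hF : ConvergesTo F f) (h : ∀ q, ‖q‖ < 1 → f q = g q) : ConvergesTo F g :=
  fun q hq ↦ h q hq ▸ hF q hq

theorem add (hF : ConvergesTo F f) (hG : ConvergesTo G g) : ConvergesTo (F + G) (f + g) :=
  fun q hq ↦ by simpa [add_mul] using (hF q hq).add (hG q hq)

theorem monomial (n : ℕ) (a : ℂ) : ConvergesTo (PowerSeries.monomial n a) fun q ↦ a * q ^ n := by
  intro q _
  convert hasSum_single n fun k hk ↦ ?_
  · simp
  · simp [coeff_monomial, hk]

theorem C (a : ℂ) : ConvergesTo (PowerSeries.C a) fun _ ↦ a :=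
  monomial_zero_eq_C_apply a ▸ (monomial 0 a).congr fun _ _ ↦ by simp

theorem X_pow (n : ℕ) : ConvergesTo (X ^ n) fun q ↦ q ^ n := by
  rw [X_pow_eq]
  exact (monomial n 1).congr fun _ _ ↦ by simp

theorem mul (hF : ConvergesTo F f) (hG : ConvergesTo G g) : ConvergesTo (F * G) (f * g) := by
  intro q hq
  have h1 := (hF q hq).summable.norm
  have h2 := (hG q hq).summable.norm
  have h3 := summable_norm_sum_mul_antidiagonal_of_summable_norm h1 h2
  have h4 := tsum_mul_tsum_eq_tsum_sum_antidiagonal_of_summable_norm h1 h2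
  rw [(hF q hq).tsum_eq, (hG q hq).tsum_eq] at h4
  rw [Pi.mul_apply, h4]
  convert! h3.of_norm.hasSum using 2 with n
  rw [coeff_mul, Finset.sum_mul]
  refine Finset.sum_congr rfl fun p hp ↦ ?_
  rw [← Finset.HasAntidiagonal.mem_antidiagonal.mp hp]
  ring

theorem pow (hF : ConvergesTo F f) (n : ℕ) : ConvergesTo (F ^ n) (f ^ n) := by
  induction n with
  | zero =>
    rw [pow_zero, pow_zero]
    exact C 1
  | succ n ih => exact ih.mul hF

theorem sum {ι : Type*} (s : Finset ι) {F : ι → ℂ⟦X⟧} {f : ι → ℂ → ℂ}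
    (h : ∀ i ∈ s, ConvergesTo (F i) (f i)) : ConvergesTo (∑ i ∈ s, F i) (∑ i ∈ s, f i) := by
  intro q hq
  simpa [Finset.sum_mul] using hasSum_sum fun i hi ↦ h i hi q hq

theorem expand (hF : ConvergesTo F f) {p : ℕ} (hp : p ≠ 0) :
    ConvergesTo (F.expand p hp) fun q ↦ f (q ^ p) := by
  intro q hq
  have hinj : Function.Injective (p * · : ℕ → ℕ) := mul_right_injective₀ hp
  rw [← hinj.hasSum_iff]
  · convert hF (q ^ p) (by rw [norm_pow]; exact pow_lt_one₀ (norm_nonneg q) hq hp) using 2 with n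
    simp [pow_mul]
  · intro n hn
    rw [coeff_expand_of_not_dvd, zero_mul]
    rintro ⟨k, rfl⟩
    exact hn ⟨k, rfl⟩

theorem exists_norm_le (hF : ConvergesTo F f) {M : ℕ} (h : ∀ n < M, F.coeff n = 0) :
    ∃ K, ∀ q : ℂ, ‖q‖ ≤ 1 / 2 → ‖f q‖ ≤ K * ‖q‖ ^ M := by
  have hs := (hF (1 / 2) (by norm_num)).summable.norm
  have hs' : Summable fun n ↦ ‖F.coeff (n + M)‖ * (1 / 2) ^ n := by
    have := ((summable_nat_add_iff M).mpr hs).mul_left (2 ^ M)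
    refine this.congr fun n ↦ ?_
    rw [norm_mul, norm_pow, pow_add, show ‖(1 / 2 : ℂ)‖ = 1 / 2 by norm_num,
      show (2 : ℝ) ^ M * (‖F.coeff (n + M)‖ * ((1 / 2) ^ n * (1 / 2) ^ M)) =
        ‖F.coeff (n + M)‖ * (1 / 2) ^ n * (2 * (1 / 2)) ^ M by rw [mul_pow]; ring]
    norm_num
  refine ⟨∑' n, ‖F.coeff (n + M)‖ * (1 / 2) ^ n, fun q hq ↦ ?_⟩
  have h1 := hF q (hq.trans_lt (by norm_num))
  have h2 : HasSum (fun n ↦ F.coeff (n + M) * q ^ (n + M)) (f q) := by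
    have := (hasSum_nat_add_iff' M).mpr h1
    rwa [Finset.sum_eq_zero fun i hi ↦ by rw [h i (Finset.mem_range.mp hi), zero_mul],
      sub_zero] at this
  refine h2.norm_le_of_bounded (hs'.hasSum.mul_right _) fun n ↦ ?_
  rw [norm_mul, norm_pow, pow_add, mul_assoc]
  gcongr

theorem eq_zero (hF : ConvergesTo F f) (h : ∀ q, q ≠ 0 → ‖q‖ < 1 → f q = 0) : F = 0 := by
  ext n
  rw [map_zero]
  induction n using Nat.strong_induction_on with
  | _ n ih =>
    have h1 := hF.add (monomial n (-F.coeff n))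
    obtain ⟨K, hK⟩ := h1.exists_norm_le (M := n + 1) (by
      intro k hk
      rcases (Nat.lt_succ_iff_lt_or_eq.mp hk) with hk | rfl
      · simp [ih k hk, coeff_monomial, hk.ne]
      · simp)
    by_contra hne
    have hpos : 0 < ‖F.coeff n‖ := norm_pos_iff.mpr hne
    have key : ∀ t : ℝ, 0 < t → t ≤ 1 / 2 → ‖F.coeff n‖ ≤ K * t := by
      intro t ht ht2
      have hnorm : ‖(t : ℂ)‖ = t := by simp [abs_of_pos ht]
      have h2 := hK t (by rw [hnorm]; exact ht2)
      rw [Pi.add_apply, h t (by exact_mod_cast ht.ne') (by rw [hnorm]; linarith), zero_add,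
        norm_mul, norm_neg, norm_pow, hnorm, pow_succ] at h2
      have : 0 < t ^ n := by positivity
      nlinarith
    have hlim : Tendsto (fun t : ℝ ↦ K * t) (𝓝[>] 0) (𝓝 0) := by
      have : Tendsto (fun t : ℝ ↦ K * t) (𝓝 0) (𝓝 (K * 0)) := (continuous_const_mul K).tendsto 0
      rw [mul_zero] at this
      exact this.mono_left nhdsWithin_le_nhds
    refine hpos.not_ge (ge_of_tendsto hlim ?_)
    filter_upwards [Ioc_mem_nhdsGT (show (0 : ℝ) < 1 / 2 by norm_num)] with t ht
    exact key t ht.1 ht.2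

theorem of_differentiableOn (hf : DifferentiableOn ℂ f (Metric.ball 0 1)) :
    ∃ F, ConvergesTo F f := by
  refine ⟨PowerSeries.mk fun n ↦ (n.factorial : ℂ)⁻¹ * iteratedDeriv n f 0, fun q hq ↦ ?_⟩
  convert! Complex.hasSum_taylorSeries_on_ball hf (z := q) (by simpa using hq) using 2 with n
  simp
  ring

end ConvergesTo

theorem convergesTo_pentagonalSeries : ConvergesTo (pentagonalSeries ℂ) eulerPhi :=
  fun _ hq ↦ hasSum_pentagonalSeries_eulerPhi hq

theorem eulerPhi_ne_zero {q : ℂ} (hq : ‖q‖ < 1) : eulerPhi q ≠ 0 := by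
  simp_rw [eulerPhi, sub_eq_add_neg]
  refine tprod_one_add_ne_zero_of_summable (fun i h ↦ ?_) ?_
  · have h1 : q ^ (i + 1) = 1 := by
      rw [← sub_eq_add_neg, sub_eq_zero] at h
      exact h.symm
    have h2 : ‖q ^ (i + 1)‖ < 1 := by
      rw [norm_pow]
      exact pow_lt_one₀ (norm_nonneg q) hq i.succ_ne_zero
    rw [h1, norm_one] at h2
    exact lt_irrefl _ h2
  · simpa using (summable_nat_add_iff 1).mpr (summable_geometric_of_lt_one (norm_nonneg q) hq)

theorem differentiableOn_eulerPhi : DifferentiableOn ℂ eulerPhi (Metric.ball 0 1) :=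
  ModularForm.differentiableOn_tprod_one_sub_pow

theorem map_pentagonalSeries {R S : Type*} [CommRing R] [CommRing S] (f : R →+* S) :
    PowerSeries.map f (pentagonalSeries R) = pentagonalSeries S := by
  ext n
  rw [coeff_map]
  by_cases h : ∃ k, pentagonal k = n
  · obtain ⟨k, rfl⟩ := h
    simp [coeff_pentagonalSeries_pentagonal]
  · rw [coeff_pentagonalSeries_eq_zero R (by simpa using h),
      coeff_pentagonalSeries_eq_zero S (by simpa using h), map_zero]

theorem convergesTo_partitionSeries :
    ConvergesTo (partitionSeries.map (Int.castRingHom ℂ)) fun q ↦ (eulerPhi q)⁻¹ := by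
  obtain ⟨F, hF⟩ := ConvergesTo.of_differentiableOn (f := fun q ↦ (eulerPhi q)⁻¹)
    (differentiableOn_eulerPhi.fun_inv fun q hq ↦ eulerPhi_ne_zero (by simpa using hq))
  have h1 : F * pentagonalSeries ℂ = 1 := by
    have := (hF.mul convergesTo_pentagonalSeries).add (ConvergesTo.C (-1))
    have := this.eq_zero fun q _ hq ↦ by simp [inv_mul_cancel₀ (eulerPhi_ne_zero hq)]
    rwa [map_neg, map_one, ← sub_eq_add_neg, sub_eq_zero] at this
  have h2 : partitionSeries.map (Int.castRingHom ℂ) * pentagonalSeries ℂ = 1 := by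
    rw [← map_pentagonalSeries (Int.castRingHom ℂ), ← map_mul,
      partitionSeries_mul_pentagonalSeries, map_one]
  have h3 : pentagonalSeries ℂ ≠ 0 := right_ne_zero_of_mul_eq_one h1
  rwa [← mul_right_cancel₀ h3 (h1.trans h2.symm)]

end Representation

section MixedRadix

/-- The set of integers represented by the mixed-radix system with digit bounds `m i` and `l`. -/
def mixedRadixSet (l s : ℕ) (m : Fin s → ℕ) (r : Fin (s + 1) → ℕ) : Set ℕ :=
  {x | ∃ j : Fin (s + 1) → ℕ,
    (∀ i : Fin s, j i.castSucc ≤ m i - 1) ∧ j (Fin.last s) ≤ l - 1 ∧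
    x = ∑ i, mixCoef s m r i * j i}

theorem zero_mem_mixedRadixSet (l s : ℕ) (m : Fin s → ℕ) (r : Fin (s + 1) → ℕ) :
    0 ∈ mixedRadixSet l s m r :=
  ⟨0, by simp, by simp, by simp⟩

theorem dvd_mixCoef_succ {s : ℕ} (hs : 0 < s) (m : Fin s → ℕ) (r : Fin (s + 1) → ℕ) (i : Fin s) :
    m ⟨0, hs⟩ ∣ mixCoef s m r i.succ :=
  (Finset.dvd_prod_of_mem m (Finset.mem_filter.mpr ⟨Finset.mem_univ _, Nat.succ_pos _⟩)).mul_right _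

theorem mem_mixedRadixSet_iff_mul_div_mem {l s : ℕ} (hs : 0 < s) {m : Fin s → ℕ}
    {r : Fin (s + 1) → ℕ} (hm : ∀ i, 0 < m i) (hr1 : r 0 = 1) (x : ℕ) :
    x ∈ mixedRadixSet l s m r ↔ m ⟨0, hs⟩ * (x / m ⟨0, hs⟩) ∈ mixedRadixSet l s m r := by
  set M := m ⟨0, hs⟩ with hM
  have hM0 : 0 < M := hm _
  have hsum (j : Fin (s + 1) → ℕ) : ∃ K, ∀ t,
      ∑ i, mixCoef s m r i * Function.update j 0 t i = t + M * K := by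
    obtain ⟨K, hK⟩ : M ∣ ∑ i : Fin s, mixCoef s m r i.succ * j i.succ :=
      Finset.dvd_sum fun i _ ↦ (dvd_mixCoef_succ hs m r i).mul_right _
    refine ⟨K, fun t ↦ ?_⟩
    rw [Fin.sum_univ_succ]
    simp only [Function.update_self, Function.update_of_ne (Fin.succ_ne_zero _), hK]
    simp [mixCoef, hr1]
  have hupd {j : Fin (s + 1) → ℕ} (h1 : ∀ i : Fin s, j i.castSucc ≤ m i - 1)
      (h2 : j (Fin.last s) ≤ l - 1) {t : ℕ} (ht : t < M) {y : ℕ}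
      (hy : y = ∑ i, mixCoef s m r i * Function.update j 0 t i) :
      y ∈ mixedRadixSet l s m r := by
    refine ⟨Function.update j 0 t, fun i ↦ ?_, ?_, hy⟩
    · by_cases hi : i.castSucc = 0
      · have hi' : i = ⟨0, hs⟩ := Fin.ext (by simpa using congrArg Fin.val hi)
        rw [hi, Function.update_self, hi', ← hM]
        omega
      · rw [Function.update_of_ne hi]
        exact h1 i
    · rw [Function.update_of_ne]
      · exact h2
      · intro h
        have := congrArg Fin.val h
        simp at this
        omega
  have hlt {j : Fin (s + 1) → ℕ} (h1 : ∀ i : Fin s, j i.castSucc ≤ m i - 1) : j 0 < M := by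
    have := h1 ⟨0, hs⟩
    simp only [← hM] at this
    have h0 : (⟨0, hs⟩ : Fin s).castSucc = 0 := rfl
    rw [h0] at this
    omega
  constructor
  · rintro ⟨j, h1, h2, hx⟩
    obtain ⟨K, hK⟩ := hsum j
    have hj := hlt h1
    rw [← Function.update_eq_self 0 j, hK] at hx
    refine hupd h1 h2 hM0 ?_
    rw [hK, hx, Nat.add_mul_div_left _ _ hM0, Nat.div_eq_of_lt hj]
    ring
  · rintro ⟨j, h1, h2, hx⟩
    obtain ⟨K, hK⟩ := hsum j
    have hj := hlt h1
    rw [← Function.update_eq_self 0 j, hK] at hx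
    have hj0 : j 0 = 0 := by
      have : M ∣ j 0 := (Nat.dvd_add_left (Dvd.intro _ rfl)).mp (hx ▸ Dvd.intro _ rfl)
      exact Nat.eq_zero_of_dvd_of_lt this hj
    refine hupd h1 h2 (Nat.mod_lt x hM0) ?_
    rw [hK]
    rw [hj0, zero_add] at hx
    rw [← hx, Nat.mod_add_div]

end MixedRadix

section Moderate

open UpperHalfPlane hiding I
open Filter Topology Asymptotics
open scoped Manifold MatrixGroups

/-- Holomorphic functions on the upper half plane with finitely many translates under the modular
group, all of which grow at most exponentially at the cusp at infinity. -/
structure IsModerate (h : ℍ → ℂ) : Prop where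
  mdifferentiable : MDiff h
  finite_orbit : (Set.range fun (γ : SL(2, ℤ)) (z : ℍ) ↦ h (γ • z)).Finite
  growth : ∀ γ : SL(2, ℤ), ∃ C : ℝ, (fun z : ℍ ↦ h (γ • z)) =O[atImInfty]
    fun z ↦ Real.exp (C * z.im)

theorem isBigO_exp_im_mono {C C' : ℝ} (h : C ≤ C') :
    (fun z : ℍ ↦ Real.exp (C * z.im)) =O[atImInfty] fun z ↦ Real.exp (C' * z.im) := by
  refine .of_bound 1 (Eventually.of_forall fun z ↦ ?_)
  rw [one_mul, Real.norm_of_nonneg (Real.exp_nonneg _), Real.norm_of_nonneg (Real.exp_nonneg _)]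
  have := z.im_pos
  gcongr

namespace IsModerate

variable {h k : ℍ → ℂ}

theorem const (a : ℂ) : IsModerate fun _ ↦ a where
  mdifferentiable := mdifferentiable_const
  finite_orbit := (Set.finite_singleton fun _ ↦ a).subset (by rintro _ ⟨γ, rfl⟩; rfl)
  growth γ := ⟨0, by simpa using isBigO_const_const a (one_ne_zero (α := ℝ)) atImInfty⟩

theorem add (hh : IsModerate h) (hk : IsModerate k) : IsModerate fun z ↦ h z + k z where
  mdifferentiable := hh.mdifferentiable.add hk.mdifferentiable
  finite_orbit := (hh.finite_orbit.image2 (fun f g z ↦ f z + g z) hk.finite_orbit).subset (by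
    rintro _ ⟨γ, rfl⟩
    exact ⟨_, ⟨γ, rfl⟩, _, ⟨γ, rfl⟩, rfl⟩)
  growth γ := by
    obtain ⟨C, hC⟩ := hh.growth γ
    obtain ⟨C', hC'⟩ := hk.growth γ
    exact ⟨max C C', (hC.trans (isBigO_exp_im_mono (le_max_left _ _))).add
      (hC'.trans (isBigO_exp_im_mono (le_max_right _ _)))⟩

theorem mul (hh : IsModerate h) (hk : IsModerate k) : IsModerate fun z ↦ h z * k z where
  mdifferentiable := hh.mdifferentiable.mul hk.mdifferentiable
  finite_orbit := (hh.finite_orbit.image2 (fun f g z ↦ f z * g z) hk.finite_orbit).subset (by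
    rintro _ ⟨γ, rfl⟩
    exact ⟨_, ⟨γ, rfl⟩, _, ⟨γ, rfl⟩, rfl⟩)
  growth γ := by
    obtain ⟨C, hC⟩ := hh.growth γ
    obtain ⟨C', hC'⟩ := hk.growth γ
    refine ⟨C + C', ?_⟩
    simpa only [add_mul, Real.exp_add] using hC.mul hC'

theorem sum {ι : Type*} (s : Finset ι) {f : ι → ℍ → ℂ} (hf : ∀ i ∈ s, IsModerate (f i)) :
    IsModerate fun z ↦ ∑ i ∈ s, f i z := by
  induction s using Finset.induction_on with
  | empty => simpa using const 0
  | insert a s ha ih =>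
    simp_rw [Finset.sum_insert ha]
    exact (hf a (Finset.mem_insert_self a s)).add
      (ih fun i hi ↦ hf i (Finset.mem_insert_of_mem hi))

end IsModerate

theorem mdifferentiable_SL_smul (γ : SL(2, ℤ)) : MDiff fun z : ℍ ↦ γ • z :=
  mdifferentiable_smul (g := γ) (by simp)

/-- Two continuous functions on a preconnected space with the same nonvanishing `n`-th power
differ by a root of unity. -/
theorem exists_eq_mul_of_pow_eq {X : Type*} [TopologicalSpace X] [PreconnectedSpace X] [Nonempty X]
    {f g : X → ℂ} (hf : Continuous f) (hg : Continuous g) {n : ℕ} (hn : 0 < n)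
    (hg0 : ∀ x, g x ≠ 0) (h : ∀ x, f x ^ n = g x ^ n) :
    ∃ ζ ∈ Polynomial.nthRootsFinset n (1 : ℂ), ∀ x, f x = ζ * g x := by
  have h1 : ∀ x, f x / g x ∈ (Polynomial.nthRootsFinset n (1 : ℂ) : Set ℂ) := fun x ↦ by
    rw [Finset.mem_coe, Polynomial.mem_nthRootsFinset hn, div_pow, h x,
      div_self (pow_ne_zero n (hg0 x))]
  have h2 : Set.Subsingleton (Set.range fun x ↦ f x / g x) :=
    ((Finset.finite_toSet _).subset (Set.range_subset_iff.mpr h1)).countable.isTotallyDisconnected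
      _ subset_rfl (isPreconnected_range (hf.div hg hg0))
  obtain ⟨x₀⟩ := ‹Nonempty X›
  refine ⟨_, h1 x₀, fun x ↦ ?_⟩
  have h3 : f x / g x = f x₀ / g x₀ := h2 ⟨x, rfl⟩ ⟨x₀, rfl⟩
  exact h3 ▸ (div_mul_cancel₀ _ (hg0 x)).symm

theorem IsModerate.of_pow {h : ℍ → ℂ} (hd : MDiff h) (h0 : ∀ z, h z ≠ 0) {n : ℕ} (hn : 0 < n)
    (hpow : IsModerate fun z ↦ h z ^ n) : IsModerate h where
  mdifferentiable := hd
  finite_orbit := by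
    have hcont : ∀ γ : SL(2, ℤ), Continuous fun z : ℍ ↦ h (γ • z) := fun γ ↦
      hd.continuous.comp (mdifferentiable_SL_smul γ).continuous
    refine Set.Finite.of_finite_fibers (fun f z ↦ f z ^ n)
      (hpow.finite_orbit.subset ?_) ?_
    · rintro _ ⟨_, ⟨γ, rfl⟩, rfl⟩
      exact ⟨γ, rfl⟩
    · rintro _ ⟨_, ⟨γ, rfl⟩, rfl⟩
      refine ((Polynomial.nthRootsFinset n (1 : ℂ)).finite_toSet.image
        fun ζ z ↦ ζ * h (γ • z)).subset ?_
      rintro _ ⟨⟨δ, rfl⟩, hδ⟩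
      obtain ⟨ζ, hζ, hζ'⟩ := exists_eq_mul_of_pow_eq (hcont δ) (hcont γ) hn
        (fun z ↦ h0 _) (fun z ↦ congrFun hδ z)
      exact ⟨ζ, hζ, funext fun z ↦ (hζ' z).symm⟩
  growth γ := by
    obtain ⟨C, hC⟩ := hpow.growth γ
    refine ⟨max C 0, IsBigO.trans (g := fun z ↦ 1 + ‖h (γ • z) ^ n‖) ?_ (IsBigO.add ?_ ?_)⟩
    · refine .of_bound 1 (Eventually.of_forall fun z ↦ ?_)
      rw [one_mul, norm_pow, Real.norm_of_nonneg (by positivity)]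
      rcases le_total ‖h (γ • z)‖ 1 with h1 | h1
      · linarith [pow_nonneg (norm_nonneg (h (γ • z))) n]
      · linarith [le_self_pow₀ h1 hn.ne']
    · simpa using isBigO_exp_im_mono (le_max_right C 0)
    · exact hC.norm_left.trans (isBigO_exp_im_mono (le_max_left C 0))

end Moderate

section DiscriminantQuotient

open UpperHalfPlane hiding I
open Filter Topology Asymptotics ModularForm
open scoped Manifold MatrixGroups Real

local notation "Δ" => ModularForm.discriminant

theorem discriminant_slash_SL (γ : SL(2, ℤ)) : Δ ∣[(12 : ℤ)] γ = Δ :=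
  SlashInvariantForm.slash_action_generators_SL2Z discriminant_S_invariant discriminant_T_invariant γ

/-- An integral matrix of determinant `M` as an element of `GL(2, ℝ)`. -/
noncomputable def fixedDetGL {M : ℤ} (hM : M ≠ 0) (A : FixedDetMatrix (Fin 2) ℤ M) :
    GL (Fin 2) ℝ :=
  Matrix.GeneralLinearGroup.mkOfDetNeZero (A.1.map (Int.cast : ℤ → ℝ)) (by
    rw [← Int.cast_det, A.2]; exact_mod_cast hM)

/-- Right multiplication of a matrix of determinant `M` by a matrix in `SL(2, ℤ)`. -/
def fixedDetMul {M : ℤ} (A : FixedDetMatrix (Fin 2) ℤ M) (γ : SL(2, ℤ)) :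
    FixedDetMatrix (Fin 2) ℤ M :=
  ⟨A.1 * γ.1, by rw [Matrix.det_mul, A.2, γ.2, mul_one]⟩

section

variable {M : ℤ} (hM : M ≠ 0) (A : FixedDetMatrix (Fin 2) ℤ M) (γ : SL(2, ℤ))

theorem fixedDetGL_smul :
    fixedDetGL hM (γ • A) = (γ : GL (Fin 2) ℝ) * fixedDetGL hM A := by
  ext i j
  simp [fixedDetGL, FixedDetMatrices.smul_coe, Matrix.mul_apply]

theorem fixedDetGL_fixedDetMul :
    fixedDetGL hM (fixedDetMul A γ) = fixedDetGL hM A * (γ : GL (Fin 2) ℝ) := by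
  ext i j
  simp [fixedDetGL, fixedDetMul, Matrix.mul_apply]

theorem det_fixedDetGL : (fixedDetGL hM A).det.val = M := by
  rw [Matrix.GeneralLinearGroup.val_det_apply]
  simp [fixedDetGL, ← Int.cast_det, A.2]

/-- The quotient of the translate of the discriminant by `A` and the discriminant. -/
noncomputable def discriminantQuotient (z : ℍ) : ℂ :=
  (Δ ∣[(12 : ℤ)] fixedDetGL hM A) z / Δ z

theorem discriminantQuotient_smul :
    discriminantQuotient hM (γ • A) = discriminantQuotient hM A := by
  ext z
  rw [discriminantQuotient, fixedDetGL_smul, SlashAction.slash_mul, ← SL_slash,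
    discriminant_slash_SL, discriminantQuotient]

theorem discriminantQuotient_apply_smul (z : ℍ) :
    discriminantQuotient hM A (γ • z) = discriminantQuotient hM (fixedDetMul A γ) z := by
  rw [discriminantQuotient, discriminantQuotient, fixedDetGL_fixedDetMul, SlashAction.slash_mul,
    ← SL_slash, SL_slash_apply, ← congrFun (discriminant_slash_SL γ) z, SL_slash_apply,
    mul_div_mul_right _ _ (zpow_ne_zero _ (denom_ne_zero _ _))]

theorem exists_reps_discriminantQuotient_eq :
    ∃ B ∈ FixedDetMatrices.reps M, discriminantQuotient hM A = discriminantQuotient hM B := by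
  induction A using FixedDetMatrices.induction_on hM with
  | h0 A h1 h2 h3 h4 => exact ⟨A, ⟨h1, h2, h3, h4⟩, rfl⟩
  | hS B ih => simpa only [discriminantQuotient_smul] using ih
  | hT B ih => simpa only [discriminantQuotient_smul] using ih

theorem finite_range_discriminantQuotient :
    (Set.range fun A : FixedDetMatrix (Fin 2) ℤ M ↦ discriminantQuotient hM A).Finite := by
  refine ((FixedDetMatrices.reps M).toFinite.image (discriminantQuotient hM)).subset ?_
  rintro _ ⟨A, rfl⟩
  obtain ⟨B, hB, h⟩ := exists_reps_discriminantQuotient_eq hM A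
  exact ⟨B, hB, h.symm⟩

theorem slash_fixedDetGL_apply (hM' : 0 < M) (z : ℍ) :
    (Δ ∣[(12 : ℤ)] fixedDetGL hM A) z =
      Δ (fixedDetGL hM A • z) * (M : ℂ) ^ 11 * denom (fixedDetGL hM A) z ^ (-12 : ℤ) := by
  have h1 : 0 < (fixedDetGL hM A).det.val := by
    rw [det_fixedDetGL]
    exact_mod_cast hM'
  rw [slash_apply, σ, if_pos h1, det_fixedDetGL, abs_of_pos (by exact_mod_cast hM')]
  rw [show (12 : ℤ) - 1 = (11 : ℕ) by norm_num, zpow_natCast,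
    Complex.ofReal_intCast, ContinuousAlgEquiv.refl_apply]

theorem discriminantQuotient_eq (hM' : 0 < M) (h : A.1 1 0 = 0) (z : ℍ) :
    discriminantQuotient hM A z =
      ((M : ℂ) ^ 11 / (A.1 1 1 : ℂ) ^ 12) * (Δ (fixedDetGL hM A • z) / Δ z) := by
  have h1 : denom (fixedDetGL hM A) z = A.1 1 1 := by simp [denom, fixedDetGL, h]
  rw [discriminantQuotient, slash_fixedDetGL_apply hM A hM', h1, zpow_neg,
    show (12 : ℤ) = (12 : ℕ) by norm_num, zpow_natCast]
  ring

theorem discriminantQuotient_ne_zero (hM' : 0 < M) (z : ℍ) :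
    discriminantQuotient hM A z ≠ 0 := by
  rw [discriminantQuotient, slash_fixedDetGL_apply hM A hM']
  exact div_ne_zero (mul_ne_zero (mul_ne_zero (discriminant_ne_zero _)
    (pow_ne_zero _ (by exact_mod_cast hM))) (zpow_ne_zero _ (denom_ne_zero _ _)))
    (discriminant_ne_zero _)

end

theorem MDifferentiable.fun_inv_of_ne_zero {f : ℍ → ℂ} (hf : MDiff f) (h : ∀ z, f z ≠ 0) :
    MDiff fun z ↦ (f z)⁻¹ := by
  rw [mdifferentiable_iff] at hf ⊢
  exact hf.fun_inv fun z _ ↦ h _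

theorem mdifferentiable_discriminant : MDiff Δ :=
  CuspForm.discriminant.holo'

section

variable {M : ℤ} (hM : M ≠ 0)

theorem mdifferentiable_discriminantQuotient (hM' : 0 < M)
    (A : FixedDetMatrix (Fin 2) ℤ M) : MDiff (discriminantQuotient hM A) := by
  have h1 : 0 < (fixedDetGL hM A).det.val := by
    rw [det_fixedDetGL]
    exact_mod_cast hM'
  have h2 : discriminantQuotient hM A = fun z ↦ Δ (fixedDetGL hM A • z) * (M : ℂ) ^ 11 *
      denom (fixedDetGL hM A) z ^ (-12 : ℤ) * (Δ z)⁻¹ := by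
    ext z
    rw [discriminantQuotient, slash_fixedDetGL_apply hM A hM', div_eq_mul_inv]
  rw [h2]
  exact (((mdifferentiable_discriminant.comp (mdifferentiable_smul h1)).mul
    mdifferentiable_const).mul (mdifferentiable_denom_zpow _ _)).mul
    (mdifferentiable_discriminant.fun_inv_of_ne_zero discriminant_ne_zero)

theorem im_fixedDetGL_smul (hM' : 0 < M) (A : FixedDetMatrix (Fin 2) ℤ M)
    (h : A.1 1 0 = 0) (z : ℍ) :
    (fixedDetGL hM A • z).im = M / (A.1 1 1 : ℝ) ^ 2 * z.im := by
  have h1 : denom (fixedDetGL hM A) z = A.1 1 1 := by simp [denom, fixedDetGL, h]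
  rw [im_smul_eq_div_normSq, det_fixedDetGL, h1, Complex.normSq_intCast,
    abs_of_pos (by exact_mod_cast hM')]
  ring

theorem discriminantQuotient_growth (hM' : 0 < M)
    (A : FixedDetMatrix (Fin 2) ℤ M) :
    ∃ C : ℝ, discriminantQuotient hM A =O[atImInfty] fun z ↦ Real.exp (C * z.im) := by
  obtain ⟨B, ⟨hB, -⟩, h⟩ := exists_reps_discriminantQuotient_eq hM A
  refine ⟨2 * π, ?_⟩
  rw [h, funext (discriminantQuotient_eq hM B hM' hB)]
  refine .const_mul_left ?_ _
  have h1 : (fun z ↦ Δ (fixedDetGL hM B • z)) =O[atImInfty] fun _ ↦ (1 : ℝ) :=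
    discriminant_isZeroAtImInfty.isBoundedAtImInfty.comp_tendsto
      (tendsto_smul_atImInfty (by simp [fixedDetGL, hB]))
  have h2 := exp_isBigO_discriminant.inv_rev (by simp)
  refine (h1.mul h2).congr (fun z ↦ (div_eq_mul_inv _ _).symm) fun z ↦ ?_
  rw [one_mul, ← Real.exp_neg]
  ring_nf

theorem discriminantQuotient_inv_growth (hM' : 0 < M)
    (A : FixedDetMatrix (Fin 2) ℤ M) :
    ∃ C : ℝ, (fun z ↦ (discriminantQuotient hM A z)⁻¹) =O[atImInfty]
      fun z ↦ Real.exp (C * z.im) := by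
  obtain ⟨B, ⟨hB, -⟩, h⟩ := exists_reps_discriminantQuotient_eq hM A
  refine ⟨2 * π * (M / (B.1 1 1 : ℝ) ^ 2), ?_⟩
  rw [h, funext (discriminantQuotient_eq hM B hM' hB)]
  simp_rw [mul_inv, inv_div]
  refine .const_mul_left ?_ _
  have h1 : Δ =O[atImInfty] fun _ ↦ (1 : ℝ) := discriminant_isZeroAtImInfty.isBoundedAtImInfty
  have h2 := (exp_isBigO_discriminant.inv_rev (by simp)).comp_tendsto
      (tendsto_smul_atImInfty (g := fixedDetGL hM B) (by simp [fixedDetGL, hB]))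
  refine (h1.mul h2).congr (fun z ↦ (div_eq_mul_inv _ _).symm) fun z ↦ ?_
  rw [one_mul, Function.comp_apply, ← Real.exp_neg, im_fixedDetGL_smul hM hM' B hB]
  ring_nf

theorem isModerate_discriminantQuotient (hM' : 0 < M)
    (A : FixedDetMatrix (Fin 2) ℤ M) : IsModerate (discriminantQuotient hM A) where
  mdifferentiable := mdifferentiable_discriminantQuotient hM hM' A
  finite_orbit := (finite_range_discriminantQuotient hM).subset (by
    rintro _ ⟨γ, rfl⟩
    exact ⟨fixedDetMul A γ, funext fun z ↦ (discriminantQuotient_apply_smul hM A γ z).symm⟩)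
  growth γ := by
    simp_rw [discriminantQuotient_apply_smul]
    exact discriminantQuotient_growth hM hM' _

theorem isModerate_discriminantQuotient_inv (hM' : 0 < M)
    (A : FixedDetMatrix (Fin 2) ℤ M) :
    IsModerate fun z ↦ (discriminantQuotient hM A z)⁻¹ where
  mdifferentiable := (mdifferentiable_discriminantQuotient hM hM' A).fun_inv_of_ne_zero
    (discriminantQuotient_ne_zero hM A hM')
  finite_orbit := ((finite_range_discriminantQuotient hM).image fun f z ↦ (f z)⁻¹).subset (by
    rintro _ ⟨γ, rfl⟩
    exact ⟨_, ⟨fixedDetMul A γ, rfl⟩,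
      funext fun z ↦ congrArg (·⁻¹) (discriminantQuotient_apply_smul hM A γ z).symm⟩)
  growth γ := by
    simp_rw [discriminantQuotient_apply_smul]
    exact discriminantQuotient_inv_growth hM hM' _

end

end DiscriminantQuotient

section QParam

open UpperHalfPlane hiding I
open Filter Topology Asymptotics ModularForm
open scoped Manifold MatrixGroups Real
open Complex (I exp)

local notation "Δ" => ModularForm.discriminant
local notation "𝕢" => Function.Periodic.qParam

theorem norm_qParam_one_lt_one (z : ℍ) : ‖𝕢 1 (z : ℂ)‖ < 1 :=
  Function.Periodic.norm_qParam_lt_one one_pos z.im_pos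

theorem discriminant_eq_qParam_mul_eulerPhi (z : ℍ) :
    Δ z = 𝕢 1 (z : ℂ) * eulerPhi (𝕢 1 (z : ℂ)) ^ 24 := by
  rw [discriminant_eq_q_prod, eulerPhi]
  congr 1
  refine Multipliable.tprod_pow ?_ 24
  exact multipliableLocallyUniformlyOn_eta.multipliable z.2

theorem mdifferentiable_comp_qParam {f : ℂ → ℂ} (hf : DifferentiableOn ℂ f (Metric.ball 0 1)) :
    MDiff fun z : ℍ ↦ f (𝕢 1 (z : ℂ)) := by
  rw [mdifferentiable_iff]
  have h1 : DifferentiableOn ℂ (fun z ↦ f (𝕢 1 z)) {z : ℂ | 0 < z.im} :=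
    hf.comp Function.Periodic.differentiable_qParam.differentiableOn fun z hz ↦ by
      simpa using Function.Periodic.norm_qParam_lt_one one_pos hz
  exact h1.congr fun z hz ↦ by simp [ofComplex_apply_of_im_pos hz]

/-- The matrix with rows `(a, b)` and `(0, d)`. -/
def upperTriangular (a b d : ℤ) : FixedDetMatrix (Fin 2) ℤ (a * d) :=
  ⟨!![a, b; 0, d], by simp [Matrix.det_fin_two]⟩

theorem coe_upperTriangular_smul {a b d : ℤ} (h : a * d ≠ 0) (h' : 0 < a * d) (z : ℍ) :
    ((fixedDetGL h (upperTriangular a b d) • z : ℍ) : ℂ) = (a * z + b) / d := by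
  rw [coe_smul_of_det_pos]
  · simp [num, denom, fixedDetGL, upperTriangular]
  · rw [det_fixedDetGL]
    exact_mod_cast h'

theorem qParam_upperTriangular_translate {m : ℕ} (hm : 0 < m) (j : ℕ)
    (h : (m : ℤ) * m ≠ 0) (z : ℍ) :
    𝕢 1 ((fixedDetGL h (upperTriangular m j m) • z : ℍ) : ℂ) =
      exp (2 * π * I / m) ^ j * 𝕢 1 (z : ℂ) := by
  have hm' : (m : ℂ) ≠ 0 := by exact_mod_cast hm.ne'
  rw [coe_upperTriangular_smul h (by positivity), Function.Periodic.qParam,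
    Function.Periodic.qParam, ← Complex.exp_nat_mul, ← Complex.exp_add]
  congr 1
  push_cast
  field_simp
  ring

theorem qParam_upperTriangular_dilate {l : ℕ} (hl : 0 < l)
    (h : (l : ℤ) * 1 ≠ 0) (z : ℍ) :
    𝕢 1 ((fixedDetGL h (upperTriangular l 0 1) • z : ℍ) : ℂ) = 𝕢 1 (z : ℂ) ^ l := by
  rw [coe_upperTriangular_smul h (by positivity), Function.Periodic.qParam,
    Function.Periodic.qParam, ← Complex.exp_nat_mul]
  congr 1
  push_cast
  ring

theorem isModerate_discriminant_dilate_div {l : ℕ} (hl : 0 < l) :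
    IsModerate fun z ↦ 𝕢 1 (z : ℂ) ^ (l - 1) * eulerPhi (𝕢 1 (z : ℂ) ^ l) ^ 24 *
      (eulerPhi (𝕢 1 (z : ℂ)))⁻¹ ^ 24 := by
  have h' : 0 < (l : ℤ) * 1 := by positivity
  convert! (IsModerate.const (l ^ 11 : ℂ)⁻¹).mul (isModerate_discriminantQuotient h'.ne' h'
    (upperTriangular l 0 1)) using 2 with z
  have hl' : (l : ℂ) ≠ 0 := by exact_mod_cast hl.ne'
  have hz := eulerPhi_ne_zero (norm_qParam_one_lt_one z)
  have hq : 𝕢 1 (z : ℂ) ≠ 0 := Function.Periodic.qParam_ne_zero _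
  rw [discriminantQuotient_eq _ _ h' (by simp [upperTriangular]),
    discriminant_eq_qParam_mul_eulerPhi, discriminant_eq_qParam_mul_eulerPhi z,
    qParam_upperTriangular_dilate hl]
  simp only [upperTriangular]
  obtain ⟨l, rfl⟩ := Nat.exists_eq_succ_of_ne_zero hl.ne'
  simp [pow_succ]
  field_simp

theorem isModerate_eulerPhi_div_translate {m : ℕ} (hm : 0 < m) (j : ℕ) :
    IsModerate fun z ↦ eulerPhi (𝕢 1 (z : ℂ)) *
      (eulerPhi (exp (2 * π * I / m) ^ j * 𝕢 1 (z : ℂ)))⁻¹ := by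
  have h' : 0 < (m : ℤ) * m := by positivity
  have hm' : (m : ℂ) ≠ 0 := by exact_mod_cast hm.ne'
  set ω := exp (2 * π * I / m) ^ j with hω
  have hω0 : ω ≠ 0 := pow_ne_zero _ (Complex.exp_ne_zero _)
  have hω1 : ‖ω‖ = 1 := by
    rw [hω, norm_pow, (Complex.isPrimitiveRoot_exp m hm.ne').norm'_eq_one hm.ne', one_pow]
  have hnorm : ∀ q : ℂ, ‖q‖ < 1 → ‖ω * q‖ < 1 := fun q hq ↦ by rwa [norm_mul, hω1, one_mul]
  refine IsModerate.of_pow ?_ ?_ (n := 24) (by norm_num) ?_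
  · refine mdifferentiable_comp_qParam (f := fun q ↦ eulerPhi q * (eulerPhi (ω * q))⁻¹) ?_
    refine differentiableOn_eulerPhi.fun_mul (DifferentiableOn.fun_inv ?_ ?_)
    · exact differentiableOn_eulerPhi.comp (by fun_prop) fun q hq ↦ by
        simpa using hnorm q (by simpa using hq)
    · exact fun q hq ↦ eulerPhi_ne_zero (hnorm q (by simpa using hq))
  · exact fun z ↦ mul_ne_zero (eulerPhi_ne_zero (norm_qParam_one_lt_one z))
      (inv_ne_zero (eulerPhi_ne_zero (hnorm _ (norm_qParam_one_lt_one z))))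
  · convert! (IsModerate.const (ω * (m ^ 2) ^ 11 / m ^ 12)).mul
      (isModerate_discriminantQuotient_inv h'.ne' h' (upperTriangular m j m)) using 2 with z
    have hz := eulerPhi_ne_zero (norm_qParam_one_lt_one z)
    have hz' := eulerPhi_ne_zero (hnorm _ (norm_qParam_one_lt_one z))
    have hq : 𝕢 1 (z : ℂ) ≠ 0 := Function.Periodic.qParam_ne_zero _
    rw [discriminantQuotient_eq _ _ h' (by simp [upperTriangular]),
      discriminant_eq_qParam_mul_eulerPhi, discriminant_eq_qParam_mul_eulerPhi z,
      qParam_upperTriangular_translate hm, ← hω]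
    simp [upperTriangular]
    field_simp

end QParam

section Norm

open UpperHalfPlane hiding I
open Filter Topology Asymptotics ModularForm
open scoped Manifold MatrixGroups Real

theorem eq_zero_of_SL_invariant {f : ℍ → ℂ} (hd : MDiff f)
    (hinv : ∀ (γ : SL(2, ℤ)) (z : ℍ), f (γ • z) = f z) (h0 : IsZeroAtImInfty f) (z : ℍ) :
    f z = 0 := by
  have hslash : ∀ γ : SL(2, ℤ), f ∣[(0 : ℤ)] γ = f := fun γ ↦ funext fun z ↦ by
    rw [SL_slash_apply, hinv, neg_zero, zpow_zero, mul_one]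
  let F : ModularForm 𝒮ℒ 0 :=
    { toFun := f
      slash_action_eq' := by
        rintro _ ⟨γ, rfl⟩
        exact hslash γ
      holo' := hd
      bdd_at_cusps' := fun hc ↦ by
        rw [Subgroup.IsArithmetic.isCusp_iff_isCusp_SL2Z] at hc
        rw [OnePoint.isBoundedAt_iff_forall_SL2Z hc]
        intro γ _
        rw [hslash]
        exact h0.isBoundedAtImInfty }
  obtain ⟨a, ha⟩ := ModularFormClass.levelOne_weight_zero_const F
  have hf : f = Function.const ℍ a := ha
  rw [hf] at h0 ⊢
  exact tendsto_nhds_unique tendsto_const_nhds h0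

theorem eq_zero_or_eq_zero_of_mdifferentiable {f g : ℍ → ℂ} (hf : MDiff f) (hg : MDiff g)
    (h : ∀ z, f z * g z = 0) : (∀ z, f z = 0) ∨ ∀ z, g z = 0 := by
  rw [mdifferentiable_iff] at hf hg
  have hf' := hf.analyticOnNhd isOpen_upperHalfPlaneSet
  have hg' := hg.analyticOnNhd isOpen_upperHalfPlaneSet
  have := hf'.eq_zero_or_eq_zero_of_mul_eq_zero hg' (fun z _ ↦ h _)
    (convex_halfSpace_im_gt 0).isPreconnected
  exact this.imp (fun h1 z ↦ by simpa using h1 z z.im_pos) fun h1 z ↦ by simpa using h1 z z.im_pos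

theorem mdifferentiable_fun_prod {ι : Type*} {s : Finset ι} {f : ι → ℍ → ℂ}
    (hf : ∀ i ∈ s, MDiff (f i)) : MDiff fun z ↦ ∏ i ∈ s, f i z := by
  induction s using Finset.induction_on with
  | empty => simpa only [Finset.prod_empty] using mdifferentiable_const
  | insert a s ha ih =>
    simp_rw [Finset.prod_insert ha]
    exact (hf a (Finset.mem_insert_self a s)).mul
      (ih fun i hi ↦ hf i (Finset.mem_insert_of_mem hi))

theorem exists_eq_zero_of_prod_eq_zero {ι : Type*} (s : Finset ι) {f : ι → ℍ → ℂ}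
    (hf : ∀ i ∈ s, MDiff (f i)) (h : ∀ z, ∏ i ∈ s, f i z = 0) : ∃ i ∈ s, ∀ z, f i z = 0 := by
  induction s using Finset.induction_on with
  | empty => simpa using h UpperHalfPlane.I
  | insert a s ha ih =>
    simp_rw [Finset.prod_insert ha] at h
    have hs : ∀ i ∈ s, MDiff (f i) := fun i hi ↦ hf i (Finset.mem_insert_of_mem hi)
    rcases eq_zero_or_eq_zero_of_mdifferentiable (hf a (Finset.mem_insert_self a s))
      (mdifferentiable_fun_prod hs) h with h1 | h1
    · exact ⟨a, Finset.mem_insert_self a s, h1⟩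
    · obtain ⟨i, hi, hi'⟩ := ih hs h1
      exact ⟨i, Finset.mem_insert_of_mem hi, hi'⟩

theorem isBigO_exp_prod {ι : Type*} (s : Finset ι) {f : ι → ℍ → ℂ} {C : ℝ}
    (hf : ∀ i ∈ s, f i =O[atImInfty] fun z ↦ Real.exp (C * z.im)) :
    (fun z ↦ ∏ i ∈ s, f i z) =O[atImInfty] fun z ↦ Real.exp (s.card * C * z.im) := by
  refine (IsBigO.finsetProd hf).congr_right fun z ↦ ?_
  rw [Finset.prod_const, ← Real.exp_nat_mul, mul_assoc]

theorem tendsto_exp_mul_im {C : ℝ} (hC : C < 0) :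
    Tendsto (fun z : ℍ ↦ Real.exp (C * z.im)) atImInfty (𝓝 0) :=
  Real.tendsto_exp_atBot.comp ((tendsto_id.const_mul_atTop_of_neg hC).comp tendsto_comap)

/-- The value at `z` of the polynomial with coefficients `c` at a pair of functions. -/
noncomputable def evalPair (s : Finset (ℕ × ℕ)) (c : ℕ × ℕ → ℂ) (o : (ℍ → ℂ) × (ℍ → ℂ)) (z : ℍ) :
    ℂ :=
  ∑ i ∈ s, c i * (o.1 z ^ i.1 * o.2 z ^ i.2)

theorem isBigO_evalPair {N : ℕ} (c : ℕ × ℕ → ℂ) {o : (ℍ → ℂ) × (ℍ → ℂ)} {C : ℝ} (hC : 0 ≤ C)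
    (h1 : o.1 =O[atImInfty] fun z ↦ Real.exp (C * z.im))
    (h2 : o.2 =O[atImInfty] fun z ↦ Real.exp (C * z.im)) :
    evalPair (Finset.range N ×ˢ Finset.range N) c o =O[atImInfty]
      fun z ↦ Real.exp (2 * N * C * z.im) := by
  unfold evalPair
  refine IsBigO.fun_sum fun i hi ↦ IsBigO.const_mul_left ?_ _
  rw [Finset.mem_product, Finset.mem_range, Finset.mem_range] at hi
  refine ((h1.pow i.1).mul (h2.pow i.2)).trans ((isBigO_exp_im_mono
    (C := (i.1 + i.2) * C) ?_).congr_left fun z ↦ ?_)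
  · have h1 : (i.1 : ℝ) ≤ N := by exact_mod_cast hi.1.le
    have h2 : (i.2 : ℝ) ≤ N := by exact_mod_cast hi.2.le
    gcongr
    linarith
  · rw [← Real.exp_nat_mul, ← Real.exp_nat_mul, ← Real.exp_add]
    ring_nf

theorem mdifferentiable_evalPair (s : Finset (ℕ × ℕ)) (c : ℕ × ℕ → ℂ) {o : (ℍ → ℂ) × (ℍ → ℂ)}
    (h1 : MDiff o.1) (h2 : MDiff o.2) : MDiff (evalPair s c o) := by
  have h : evalPair s c o = ∑ i ∈ s, fun z ↦ c i * (o.1 z ^ i.1 * o.2 z ^ i.2) :=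
    (Finset.sum_fn s _).symm
  rw [h]
  exact MDifferentiable.sum fun i _ ↦ mdifferentiable_const.mul ((h1.pow i.1).mul (h2.pow i.2))

/-- A polynomial of degree less than `N` in two moderate functions that decays fast enough
at infinity vanishes identically. -/
theorem IsModerate.exists_decay_bound {u v : ℍ → ℂ} (hu : IsModerate u) (hv : IsModerate v) :
    ∃ K : ℝ, 0 ≤ K ∧ ∀ (N : ℕ) (c : ℕ × ℕ → ℂ) (M : ℝ), K * N < M →
      (evalPair (Finset.range N ×ˢ Finset.range N) c (u, v) =O[atImInfty]
        fun z ↦ Real.exp (-M * z.im)) →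
      ∀ z, evalPair (Finset.range N ×ˢ Finset.range N) c (u, v) z = 0 := by
  let tr (γ : SL(2, ℤ)) (o : (ℍ → ℂ) × (ℍ → ℂ)) : (ℍ → ℂ) × (ℍ → ℂ) :=
    (fun z ↦ o.1 (γ • z), fun z ↦ o.2 (γ • z))
  have htr : ∀ γ δ o, tr γ (tr δ o) = tr (δ * γ) o := fun γ δ o ↦ by simp only [tr, mul_smul]
  have hfin : (Set.range fun γ ↦ tr γ (u, v)).Finite :=
    (hu.finite_orbit.prod hv.finite_orbit).subset (by
      rintro _ ⟨γ, rfl⟩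
      exact ⟨⟨γ, rfl⟩, ⟨γ, rfl⟩⟩)
  let O := hfin.toFinset
  have hO : ∀ o, o ∈ O ↔ ∃ γ, tr γ (u, v) = o := fun o ↦ hfin.mem_toFinset
  have huv : (u, v) ∈ O := (hO _).mpr ⟨1, by simp only [tr, one_smul]⟩
  have hgrowth : ∀ o ∈ O, ∃ C : ℝ, (o.1 =O[atImInfty] fun z ↦ Real.exp (C * z.im)) ∧
      o.2 =O[atImInfty] fun z ↦ Real.exp (C * z.im) := fun o ho ↦ by
    obtain ⟨γ, rfl⟩ := (hO o).mp ho
    obtain ⟨C, hC⟩ := hu.growth γ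
    obtain ⟨C', hC'⟩ := hv.growth γ
    exact ⟨max C C', hC.trans (isBigO_exp_im_mono (le_max_left _ _)),
      hC'.trans (isBigO_exp_im_mono (le_max_right _ _))⟩
  choose! C hC using hgrowth
  obtain ⟨B, hB⟩ := (O.image C).exists_le
  have hB' : ∀ o ∈ O, C o ≤ max B 0 := fun o ho ↦
    (hB _ (Finset.mem_image_of_mem C ho)).trans (le_max_left _ _)
  have hB0 : 0 ≤ max B 0 := le_max_right _ _
  refine ⟨(O.erase (u, v)).card * (2 * max B 0), by positivity, fun N c M hM hdecay ↦ ?_⟩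
  set s := Finset.range N ×ˢ Finset.range N with hs
  have hdiff : ∀ o ∈ O, MDiff (evalPair s c o) := fun o ho ↦ by
    obtain ⟨γ, rfl⟩ := (hO o).mp ho
    exact mdifferentiable_evalPair s c (hu.mdifferentiable.comp (mdifferentiable_SL_smul γ))
      (hv.mdifferentiable.comp (mdifferentiable_SL_smul γ))
  have hinv : ∀ (γ : SL(2, ℤ)) (z : ℍ),
      ∏ o ∈ O, evalPair s c o (γ • z) = ∏ o ∈ O, evalPair s c o z := fun γ z ↦ by
    have hmem : ∀ δ, ∀ o ∈ O, tr δ o ∈ O := fun δ o ho ↦ by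
      obtain ⟨ε, rfl⟩ := (hO o).mp ho
      exact (hO _).mpr ⟨ε * δ, (htr _ _ _).symm⟩
    refine Finset.prod_nbij' (tr γ) (tr γ⁻¹) (hmem γ) (hmem γ⁻¹) ?_ ?_ fun _ _ ↦ rfl
    · intro o _
      rw [htr, mul_inv_cancel]
      simp only [tr, one_smul]
    · intro o _
      rw [htr, inv_mul_cancel]
      simp only [tr, one_smul]
  have hzero : IsZeroAtImInfty fun z ↦ ∏ o ∈ O, evalPair s c o z := by
    have h1 := hdecay.mul (isBigO_exp_prod (O.erase (u, v)) (f := fun o ↦ evalPair s c o)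
      fun o ho ↦ by
        have ho' := Finset.mem_of_mem_erase ho
        exact isBigO_evalPair (N := N) c hB0
          ((hC o ho').1.trans (isBigO_exp_im_mono (hB' o ho')))
          ((hC o ho').2.trans (isBigO_exp_im_mono (hB' o ho'))))
    refine (h1.congr (fun z ↦ Finset.mul_prod_erase O (fun o ↦ evalPair s c o z) huv)
      fun z ↦ by rw [← Real.exp_add, ← add_mul]).trans_tendsto (tendsto_exp_mul_im ?_)
    linarith
  have hprod := eq_zero_of_SL_invariant (mdifferentiable_fun_prod hdiff) hinv hzero
  obtain ⟨o, ho, ho'⟩ := exists_eq_zero_of_prod_eq_zero O hdiff hprod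
  obtain ⟨γ, rfl⟩ := (hO o).mp ho
  intro z
  have := ho' (γ⁻¹ • z)
  simpa only [evalPair, tr, smul_inv_smul] using this

end Norm

section ModerateDependency

open UpperHalfPlane hiding I
open Filter Topology Asymptotics PowerSeries
open scoped Manifold MatrixGroups Real Matrix

local notation "𝕢" => Function.Periodic.qParam

theorem exists_int_vec_mulVec_eq_zero {α β : Type*} [Fintype α] [Fintype β]
    (A : Matrix α β ℤ) (h : Fintype.card α < Fintype.card β) (hα : 0 < Fintype.card α) :
    ∃ t : β → ℤ, t ≠ 0 ∧ A *ᵥ t = 0 := by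
  obtain ⟨t, ht, htA, -⟩ := Int.Matrix.exists_ne_zero_int_vec_norm_le A h hα
  exact ⟨t, ht, htA⟩

/-- Fewer than `s.card` initial coefficients of a combination of integral power series indexed by
`s` can be made to vanish. -/
theorem exists_coeff_sum_eq_zero {ι : Type*} (s : Finset ι) (W : ι → ℤ⟦X⟧) {M : ℕ} (hM : 0 < M)
    (h : M < s.card) : ∃ c : ι → ℤ, (∃ i ∈ s, c i ≠ 0) ∧
      ∀ n < M, (∑ i ∈ s, C (c i) * W i).coeff n = 0 := by
  obtain ⟨t, ht, ht'⟩ := exists_int_vec_mulVec_eq_zero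
    (Matrix.of fun (n : Fin M) (i : s) ↦ (W i).coeff n)
    (by rwa [Fintype.card_fin, Fintype.card_coe]) (by rwa [Fintype.card_fin])
  obtain ⟨i, hi⟩ := Function.ne_iff.mp ht
  refine ⟨fun i ↦ if hi : i ∈ s then t ⟨i, hi⟩ else 0, ⟨i, i.2, by simpa using hi⟩, fun n hn ↦ ?_⟩
  rw [map_sum, ← Finset.sum_coe_sort s]
  have := congrFun ht' ⟨n, hn⟩
  simp only [Matrix.mulVec, dotProduct, Matrix.of_apply, Pi.zero_apply] at this
  refine (Finset.sum_congr rfl fun i _ ↦ ?_).trans this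
  simp only [coeff_C_mul, i.2, dite_true, Subtype.coe_eta]
  exact mul_comm _ _

/-- A vanishing integral combination can be made primitive at any prime. -/
theorem exists_sum_eq_zero_not_dvd {ι : Type*} {s : Finset ι} {W : ι → ℤ⟦X⟧} {c : ι → ℤ}
    (hc : ∃ i ∈ s, c i ≠ 0) (h : ∑ i ∈ s, C (c i) * W i = 0) {ℓ : ℤ} (hℓ : ¬ IsUnit ℓ) :
    ∃ g : ι → ℤ, (∃ i ∈ s, ¬ ℓ ∣ g i) ∧ ∑ i ∈ s, C (g i) * W i = 0 := by
  obtain ⟨i, hi, hci⟩ := hc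
  obtain ⟨g, hg, hg1⟩ := s.extract_gcd c ⟨i, hi⟩
  refine ⟨g, ?_, ?_⟩
  · by_contra! hdvd
    exact hℓ (isUnit_of_dvd_one (hg1 ▸ Finset.dvd_gcd hdvd))
  · have h0 : s.gcd c ≠ 0 := fun h0 ↦ hci (by rw [hg i hi, h0, zero_mul])
    have h1 : C (s.gcd c) * ∑ i ∈ s, C (g i) * W i = 0 := by
      rw [Finset.mul_sum, ← h]
      refine Finset.sum_congr rfl fun i hi ↦ ?_
      rw [← mul_assoc, ← map_mul, ← hg i hi]
    refine (mul_eq_zero.mp h1).resolve_left fun h2 ↦ h0 ?_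
    exact (map_eq_zero_iff _ PowerSeries.C_injective).mp h2

theorem ConvergesTo.isBigO_qParam {F : ℂ⟦X⟧} {f : ℂ → ℂ} (hF : ConvergesTo F f) {M : ℕ}
    (h : ∀ n < M, F.coeff n = 0) :
    (fun z : ℍ ↦ f (𝕢 1 (z : ℂ))) =O[atImInfty] fun z ↦ Real.exp (-M * z.im) := by
  obtain ⟨K, hK⟩ := hF.exists_norm_le h
  have h1 : ∀ᶠ z : ℍ in atImInfty, ‖𝕢 1 (z : ℂ)‖ ≤ 1 / 2 :=
    (qParam_tendsto_atImInfty one_pos).norm.eventually_le_const (by norm_num)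
  have h2 : (fun z : ℍ ↦ f (𝕢 1 (z : ℂ))) =O[atImInfty]
      fun z ↦ Real.exp ((-(2 * π * M)) * z.im) := by
    refine .of_bound K ?_
    filter_upwards [h1] with z hz
    refine (hK _ hz).trans_eq ?_
    rw [Function.Periodic.norm_qParam, ← Real.exp_nat_mul, Real.norm_of_nonneg (Real.exp_nonneg _),
      coe_im]
    ring_nf
  refine h2.trans (isBigO_exp_im_mono ?_)
  have : (0 : ℝ) ≤ M := M.cast_nonneg
  nlinarith [Real.two_le_pi]

theorem ConvergesTo.eq_zero_of_qParam {F : ℂ⟦X⟧} {f : ℂ → ℂ} (hF : ConvergesTo F f)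
    (h : ∀ z : ℍ, f (𝕢 1 (z : ℂ)) = 0) : F = 0 :=
  hF.eq_zero fun q hq hq' ↦ by
    have := h ⟨Function.Periodic.invQParam 1 q,
      Function.Periodic.im_invQParam_pos_of_norm_lt_one one_pos hq' hq⟩
    rwa [coe_mk, Function.Periodic.qParam_right_inv one_ne_zero hq] at this

/-- Two integral power series whose sums are moderate functions on the upper half plane are
algebraically dependent, with a relation that stays nontrivial modulo a given prime. -/
theorem exists_dependency {U V : ℤ⟦X⟧} {u v : ℂ → ℂ}
    (hU : ConvergesTo (U.map (Int.castRingHom ℂ)) u)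
    (hV : ConvergesTo (V.map (Int.castRingHom ℂ)) v)
    (hu : IsModerate fun z ↦ u (𝕢 1 (z : ℂ))) (hv : IsModerate fun z ↦ v (𝕢 1 (z : ℂ)))
    {ℓ : ℤ} (hℓ : ¬ IsUnit ℓ) :
    ∃ (s : Finset (ℕ × ℕ)) (c : ℕ × ℕ → ℤ), (∃ i ∈ s, ¬ ℓ ∣ c i) ∧
      ∑ i ∈ s, C (c i) * (U ^ i.1 * V ^ i.2) = 0 := by
  obtain ⟨K, hK0, hK⟩ := hu.exists_decay_bound hv
  obtain ⟨N, hN⟩ := exists_nat_gt (K + 2)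
  have hN2 : 2 < N := by
    have : (2 : ℝ) < N := by linarith
    exact_mod_cast this
  set s := Finset.range N ×ˢ Finset.range N with hs
  have hcard : s.card = N * N := by rw [hs, Finset.card_product, Finset.card_range]
  have hNN : 2 * N < N * N := by gcongr
  obtain ⟨c, hc, hcoeff⟩ := exists_coeff_sum_eq_zero s (fun i ↦ U ^ i.1 * V ^ i.2)
    (M := N * N - 1) (by omega) (by omega)
  refine ⟨s, exists_sum_eq_zero_not_dvd hc ?_ hℓ⟩
  set F := ∑ i ∈ s, C (c i) * (U ^ i.1 * V ^ i.2) with hF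
  have hconv : ConvergesTo (F.map (Int.castRingHom ℂ))
      (∑ i ∈ s, fun q ↦ (c i : ℂ) * (u q ^ i.1 * v q ^ i.2)) := by
    rw [hF, map_sum]
    refine ConvergesTo.sum s fun i _ ↦ ?_
    rw [map_mul, map_mul, map_pow, map_pow, PowerSeries.map_C, eq_intCast]
    exact (ConvergesTo.C _).mul ((hU.pow _).mul (hV.pow _))
  have hval : ∀ z : ℍ, (∑ i ∈ s, fun q ↦ (c i : ℂ) * (u q ^ i.1 * v q ^ i.2)) (𝕢 1 (z : ℂ)) =
      evalPair s (fun i ↦ c i) (fun z ↦ u (𝕢 1 (z : ℂ)), fun z ↦ v (𝕢 1 (z : ℂ))) z :=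
    fun z ↦ Finset.sum_apply _ _ _
  have hzero := hconv.eq_zero_of_qParam fun z ↦ by
    rw [hval]
    refine hK N _ ((N * N - 1 : ℕ) : ℝ) ?_ ?_ z
    · rw [Nat.cast_sub (by omega)]
      push_cast
      nlinarith
    · exact (hconv.isBigO_qParam fun n hn ↦ by
        rw [PowerSeries.coeff_map, hcoeff n hn, map_zero]).congr_left hval
  exact (map_eq_zero_iff _ (PowerSeries.map_injective _
    (RingHom.injective_int (Int.castRingHom ℂ)))).mp hzero

end ModerateDependency

section ResidueClass

open PowerSeries
open Complex (I exp)
open scoped Real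

local notation "𝕢" => Function.Periodic.qParam

theorem ConvergesTo.rescale {F : ℂ⟦X⟧} {f : ℂ → ℂ} (hF : ConvergesTo F f) {w : ℂ}
    (hw : ‖w‖ ≤ 1) : ConvergesTo (PowerSeries.rescale w F) fun q ↦ f (w * q) := by
  intro q hq
  convert hF (w * q) (by
    rw [norm_mul]
    exact (mul_le_of_le_one_left (norm_nonneg q) hw).trans_lt hq) using 2 with n
  rw [coeff_rescale, mul_pow]
  ring

theorem IsPrimitiveRoot.sum_range_inv_pow_mul_pow {K : Type*} [Field K] {ω : K} {m : ℕ}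
    (hω : IsPrimitiveRoot ω m) (hm : 0 < m) (r n : ℕ) :
    ∑ j ∈ Finset.range m, (ω ^ j)⁻¹ ^ r * (ω ^ j) ^ n = if n ≡ r [MOD m] then (m : K) else 0 := by
  have hω0 : ω ≠ 0 := hω.ne_zero hm.ne'
  have h1 : ∀ j, (ω ^ j)⁻¹ ^ r * (ω ^ j) ^ n = (ω ^ n / ω ^ r) ^ j := fun j ↦ by
    rw [inv_pow, div_pow, ← pow_mul, ← pow_mul, ← pow_mul, ← pow_mul, mul_comm j r, mul_comm j n,
      div_eq_inv_mul]
  simp_rw [h1]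
  have h2 : ω ^ n / ω ^ r = 1 ↔ n ≡ r [MOD m] := by
    rw [← zpow_natCast, ← zpow_natCast, ← zpow_sub₀ hω0, hω.zpow_eq_one_iff_dvd, Nat.ModEq.comm,
      Nat.modEq_iff_dvd]
  split_ifs with h
  · rw [h2.mpr h]
    simp
  · have h3 := mul_neg_geom_sum (ω ^ n / ω ^ r) m
    rw [div_pow, ← pow_mul, ← pow_mul, mul_comm n, mul_comm r, pow_mul, pow_mul, hω.pow_eq_one,
      one_pow, one_pow, div_one, sub_self] at h3
    exact (mul_eq_zero.mp h3).resolve_left (sub_ne_zero.mpr fun h4 ↦ h (h2.mp h4.symm))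

/-- The subseries supported on a residue class, as an average over roots of unity. -/
theorem ConvergesTo.residueClass {F : ℂ⟦X⟧} {f : ℂ → ℂ} (hF : ConvergesTo F f) {ω : ℂ} {m : ℕ}
    (hω : IsPrimitiveRoot ω m) (hm : 0 < m) (r : ℕ) :
    ConvergesTo (PowerSeries.mk fun n ↦ if n ≡ r [MOD m] then F.coeff n else 0)
      (∑ j ∈ Finset.range m, fun q ↦ (m : ℂ)⁻¹ * (ω ^ j)⁻¹ ^ r * f (ω ^ j * q)) := by
  have h : (PowerSeries.mk fun n ↦ if n ≡ r [MOD m] then F.coeff n else 0) =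
      ∑ j ∈ Finset.range m, PowerSeries.C ((m : ℂ)⁻¹ * (ω ^ j)⁻¹ ^ r) *
        PowerSeries.rescale (ω ^ j) F := by
    ext n
    have hm' : (m : ℂ) ≠ 0 := by exact_mod_cast hm.ne'
    have h1 := hω.sum_range_inv_pow_mul_pow hm r n
    simp only [coeff_mk, map_sum, coeff_C_mul, coeff_rescale]
    have h2 : ∀ j, (m : ℂ)⁻¹ * (ω ^ j)⁻¹ ^ r * ((ω ^ j) ^ n * F.coeff n) =
        (m : ℂ)⁻¹ * ((ω ^ j)⁻¹ ^ r * (ω ^ j) ^ n) * F.coeff n := fun j ↦ by ring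
    simp_rw [h2]
    rw [← Finset.sum_mul, ← Finset.mul_sum, h1]
    split_ifs
    · rw [inv_mul_cancel₀ hm', one_mul]
    · rw [mul_zero, zero_mul]
  rw [h]
  refine ConvergesTo.sum _ fun j _ ↦ (ConvergesTo.C _).mul (hF.rescale ?_)
  rw [norm_pow, hω.norm'_eq_one hm.ne', one_pow]

/-- If an integral multiple of a power series is the generating function of the partition numbers
in a residue class, then its product with the pentagonal series sums to a moderate function. -/
theorem exists_convergesTo_residueClass {m : ℕ} (hm : 0 < m) (r : ℕ) {a : ℤ⟦X⟧} {D : ℤ}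
    (hD : D ≠ 0)
    (ha : ∀ n, D * a.coeff n = if n ≡ r [MOD m] then partitionSeries.coeff n else 0) :
    ∃ u : ℂ → ℂ, ConvergesTo ((a * pentagonalSeries ℤ).map (Int.castRingHom ℂ)) u ∧
      IsModerate fun z ↦ u (𝕢 1 (z : ℂ)) := by
  have hD' : (D : ℂ) ≠ 0 := by exact_mod_cast hD
  have hω := Complex.isPrimitiveRoot_exp m hm.ne'
  have h1 := ((ConvergesTo.C (D : ℂ)⁻¹).mul
    (convergesTo_partitionSeries.residueClass hω hm r)).mul convergesTo_pentagonalSeries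
  refine ⟨_, Eq.subst (motive := fun G ↦ ConvergesTo G _) ?_ h1, ?_⟩
  · rw [map_mul, map_pentagonalSeries]
    congr 1
    ext n
    rw [coeff_C_mul, coeff_mk, coeff_map, coeff_map, inv_mul_eq_iff_eq_mul₀ hD']
    have := congrArg (Int.cast : ℤ → ℂ) (ha n)
    push_cast at this
    simpa using this.symm
  · have h2 := (IsModerate.const (D : ℂ)⁻¹).mul (IsModerate.sum (Finset.range m) fun j _ ↦
      (IsModerate.const ((m : ℂ)⁻¹ * (exp (2 * π * I / m) ^ j)⁻¹ ^ r)).mul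
        (isModerate_eulerPhi_div_translate hm j))
    convert! h2 using 2 with z
    simp only [Pi.mul_apply, Finset.sum_apply]
    rw [mul_assoc, Finset.sum_mul]
    congr 1
    refine Finset.sum_congr rfl fun j _ ↦ ?_
    ring

/-- The quotient `q ^ (ℓ - 1) φ(q ^ ℓ) ^ 24 / φ(q) ^ 24` as an integral power series. -/
noncomputable def discriminantDilateSeries (ℓ : ℕ) (hℓ : ℓ ≠ 0) : ℤ⟦X⟧ :=
  X ^ (ℓ - 1) * (pentagonalSeries ℤ).expand ℓ hℓ ^ 24 * partitionSeries ^ 24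

theorem convergesTo_discriminantDilateSeries {ℓ : ℕ} (hℓ : ℓ ≠ 0) :
    ConvergesTo ((discriminantDilateSeries ℓ hℓ).map (Int.castRingHom ℂ))
      fun q ↦ q ^ (ℓ - 1) * eulerPhi (q ^ ℓ) ^ 24 * (eulerPhi q)⁻¹ ^ 24 := by
  rw [discriminantDilateSeries, map_mul, map_mul, map_pow, map_pow, map_pow, map_X, map_expand,
    map_pentagonalSeries]
  exact ((ConvergesTo.X_pow _).mul ((convergesTo_pentagonalSeries.expand hℓ).pow 24)).mul
    (convergesTo_partitionSeries.pow 24)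

theorem map_discriminantDilateSeries {ℓ : ℕ} [hp : Fact ℓ.Prime] :
    (discriminantDilateSeries ℓ hp.out.ne_zero).map (Int.castRingHom (ZMod ℓ)) =
      X ^ (ℓ - 1) * pentagonalSeries (ZMod ℓ) ^ (24 * (ℓ - 1)) := by
  have h1 : partitionSeries.map (Int.castRingHom (ZMod ℓ)) * pentagonalSeries (ZMod ℓ) = 1 := by
    rw [← map_pentagonalSeries (Int.castRingHom (ZMod ℓ)), ← map_mul,
      partitionSeries_mul_pentagonalSeries, map_one]
  have h2 : (pentagonalSeries (ZMod ℓ)).expand ℓ hp.out.ne_zero = pentagonalSeries (ZMod ℓ) ^ ℓ := by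
    have := PowerSeries.pow_prime_pow_eq_expand (pentagonalSeries (ZMod ℓ)) 1
      (by rw [pow_one]; exact hp.out.ne_zero)
    simpa only [pow_one] using this.symm
  rw [discriminantDilateSeries, map_mul, map_mul, map_pow, map_pow, map_pow, map_X, map_expand,
    map_pentagonalSeries, h2]
  have h3 : ∀ E S : (ZMod ℓ)⟦X⟧, S * E = 1 → ∀ k,
      (E ^ (k + 1)) ^ 24 * S ^ 24 = E ^ (24 * k) := fun E S h k ↦ by
    rw [pow_succ E k, mul_pow, mul_assoc, ← mul_pow, mul_comm E, h, one_pow, mul_one, ← pow_mul,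
      mul_comm k]
  rw [mul_assoc]
  congr 1
  have := h3 _ _ h1 (ℓ - 1)
  rwa [Nat.sub_add_cancel hp.out.one_le] at this

/-- An integral power series proportional to the partition generating function on a residue class
cannot be a nonzero polynomial modulo a prime. -/
theorem map_eq_zero_of_eq_polynomial {m : ℕ} (hm : 0 < m) (r : ℕ) {a : ℤ⟦X⟧} {D : ℤ}
    (hD : D ≠ 0)
    (ha : ∀ n, D * a.coeff n = if n ≡ r [MOD m] then partitionSeries.coeff n else 0)
    {ℓ : ℕ} [hp : Fact ℓ.Prime] {P : Polynomial (ZMod ℓ)}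
    (hP : a.map (Int.castRingHom (ZMod ℓ)) = P) : P = 0 := by
  by_contra hP0
  obtain ⟨u, hu, hu'⟩ := exists_convergesTo_residueClass hm r hD ha
  obtain ⟨s, c, ⟨i, hi, hci⟩, hsum⟩ := exists_dependency hu
    (convergesTo_discriminantDilateSeries hp.out.ne_zero) hu'
    (isModerate_discriminant_dilate_div hp.out.pos) (Nat.prime_iff_prime_int.mp hp.out).not_isUnit
  refine hci ((ZMod.intCast_zmod_eq_zero_iff_dvd _ _).mp
    (eq_zero_of_pentagonalSeries_dependency hP0 s (fun i ↦ (c i : ZMod ℓ)) ?_ i hi))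
  have := congrArg (PowerSeries.map (Int.castRingHom (ZMod ℓ))) hsum
  rw [map_sum, map_zero] at this
  rw [← this]
  refine Finset.sum_congr rfl fun i _ ↦ ?_
  rw [map_mul, map_mul, map_pow, map_pow, map_mul, map_C, map_discriminantDilateSeries, hP,
    map_pentagonalSeries, eq_intCast, mul_assoc]

/-- A congruence for the partition function on the tail of an arithmetic progression extends to
the whole residue class. -/
theorem dvd_card_partition_of_forall_dvd {m c d : ℕ} (hm : 0 < m)
    (h : ∀ n, d ∣ Fintype.card (Nat.Partition (m * n + c))) {N : ℕ} (hN : N ≡ c [MOD m]) :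
    d ∣ Fintype.card (Nat.Partition N) := by
  rw [Nat.dvd_iff_prime_pow_dvd_dvd]
  intro ℓ k hℓ hk
  have hp : Fact ℓ.Prime := ⟨hℓ⟩
  let b : ℕ → ℤ := fun n ↦ if n ≡ c [MOD m] then partitionSeries.coeff n else 0
  have hb : ∀ n, c ≤ n → (ℓ : ℤ) ^ k ∣ b n := fun n hn ↦ by
    simp only [b]
    split_ifs with hnc
    · obtain ⟨t, ht⟩ := (Nat.modEq_iff_dvd' hn).mp hnc.symm
      obtain rfl : n = m * t + c := by omega
      rw [partitionSeries, coeff_mk]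
      exact_mod_cast hk.trans (h t)
    · exact dvd_zero _
  suffices hall : ∀ e ≤ k, ∀ n, (ℓ : ℤ) ^ e ∣ b n by
    have := hall k le_rfl N
    simp only [b, if_pos hN, partitionSeries, coeff_mk] at this
    exact_mod_cast this
  intro e
  induction e with
  | zero => simp
  | succ e ih =>
    intro he
    choose a ha using ih (by omega)
    have hD : (ℓ : ℤ) ^ e ≠ 0 := pow_ne_zero _ (by exact_mod_cast hℓ.ne_zero)
    have hdvd : ∀ n, c ≤ n → (ℓ : ℤ) ∣ a n := fun n hn ↦ by
      have := (pow_dvd_pow (ℓ : ℤ) he).trans (hb n hn)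
      rw [ha, pow_succ] at this
      exact (mul_dvd_mul_iff_left hD).mp this
    have hzero := map_eq_zero_of_eq_polynomial hm c (a := PowerSeries.mk a) hD
      (fun n ↦ by rw [coeff_mk, ← ha]) (ℓ := ℓ)
      (P := trunc c ((PowerSeries.mk a).map (Int.castRingHom (ZMod ℓ)))) (by
        ext n
        rw [Polynomial.coeff_coe, coeff_trunc]
        split_ifs with hn
        · rfl
        · rw [coeff_map, coeff_mk, eq_intCast, ZMod.intCast_zmod_eq_zero_iff_dvd]
          exact hdvd n (not_lt.mp hn))
    intro n
    rw [ha, pow_succ, mul_dvd_mul_iff_left hD]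
    rcases lt_or_ge n c with hn | hn
    · have := congrArg (Polynomial.coeff · n) hzero
      simpa [coeff_trunc, hn, ZMod.intCast_zmod_eq_zero_iff_dvd] using this
    · exact hdvd n hn

end ResidueClass

/-- Congruence transfer for the mixed-radix partition theorem (with r₁ = 1). -/
theorem mixed_radix_congruence (l s : ℕ) (hl : 0 < l) (hs : 0 < s)
    (m : Fin s → ℕ) (r : Fin (s + 1) → ℕ)
    (hm : ∀ i, 0 < m i) (hr : ∀ i, 0 < r i)
    (hchain : ∀ i : Fin s, r i.castSucc ∣ r i.succ)
    (hr1 : r 0 = 1)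
    (c d : ℕ) (hc : 0 < c) (hd : 0 < d)
    (hp : ∀ n : ℕ, d ∣ Fintype.card (Nat.Partition (m ⟨0, hs⟩ * n + c))) :
    ∀ n : ℕ, d ∣ partP {x | ∃ j : Fin (s + 1) → ℕ,
        (∀ i : Fin s, j i.castSucc ≤ m i - 1) ∧ j (Fin.last s) ≤ l - 1 ∧
        x = ∑ i, mixCoef s m r i * j i} (m ⟨0, hs⟩ * n + c) := by
  intro n
  have hmod : ∀ k, m ⟨0, hs⟩ * k + c ≡ c [MOD m ⟨0, hs⟩] := fun k ↦ by
    simp [Nat.ModEq]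
  exact dvd_partP_of_dvd_partition (zero_mem_mixedRadixSet l s m r)
    (mem_mixedRadixSet_iff_mul_div_mem hs hm hr1)
    (fun _ hN ↦ dvd_card_partition_of_forall_dvd (hm _) hp hN) (hmod n)
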